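/- Let F be a field of characteristic 2, let D be a finite-dimensional central division F-algebra, and let ψ be a nonsingular quadratic form over F of dimension ≥ 2 with nontrivial Arf invariant Δ(ψ) ≠ 0. Then D ⊗_F F(ψ) is not a division algebra if and only if D contains an F-subalgebra isomorphic to the even Clifford algebra C₀(ψ) of ψ. -/

import Mathlib

open QuadraticMap MvPolynomial
open scoped TensorProduct

set_option synthInstance.maxHeartbeats 1000000
set_option maxHeartbeats 1000000


section Defs

variable {K : Type} [CommRing K]

/-- The binary quadratic form `[a,b] : (x,y) ↦ a·x² + x·y + b·y²`. -/
noncomputable def binQF (a b : K) : QuadraticForm K (Fin 2 → K) :=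
  (Matrix.of ![![a, 1], ![0, b]]).toQuadraticMap'

/-- The diagonal (totally singular) quadratic form `⟨c₁, …, c_s⟩`. -/
noncomputable def diagQF {s : ℕ} (c : Fin s → K) : QuadraticForm K (Fin s → K) :=
  QuadraticMap.weightedSumSquares K c

/-- The orthogonal sum `[a₁,b₁] ⊥ ⋯ ⊥ [a_r,b_r]` of binary forms. -/
noncomputable def binsQF {r : ℕ} (a b : Fin r → K) : QuadraticForm K (Fin r → Fin 2 → K) :=
  QuadraticMap.pi fun i => binQF (a i) (b i)

/-- The orthogonal sum of `m` hyperbolic planes `[0,0]`. -/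
noncomputable def hypQF (K : Type) [CommRing K] (m : ℕ) :
    QuadraticForm K (Fin m → Fin 2 → K) :=
  binsQF (fun _ => 0) (fun _ => 0)

/-- The `(n+1)`-fold quadratic Pfister form `⟨⟨a₁,…,aₙ⟩⟩_b ⊗ [1,c]`, i.e. the orthogonal
sum over all subsets `S ⊆ {1,…,n}` of `(∏_{i∈S} aᵢ)·[1,c]`. -/
noncomputable def pfisterQF (n : ℕ) (a : Fin n → K) (c : K) :
    QuadraticForm K (Finset (Fin n) → Fin 2 → K) :=
  QuadraticMap.pi fun S : Finset (Fin n) => (∏ i ∈ S, a i) • binQF 1 c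

variable {V W : Type} [AddCommGroup V] [Module K V] [AddCommGroup W] [Module K W]

/-- `φ` has type `(r,s)`: it is isometric to `[a₁,b₁] ⊥ ⋯ ⊥ [a_r,b_r] ⊥ ⟨c₁,…,c_s⟩`. -/
def HasTypeRS (φ : QuadraticForm K V) (r s : ℕ) : Prop :=
  ∃ (a b : Fin r → K) (c : Fin s → K), φ.Equivalent ((binsQF a b).prod (diagQF c))

/-- `φ` is dominated by `ψ`. -/
def Dominated (φ : QuadraticForm K V) (ψ : QuadraticForm K W) : Prop :=
  ∃ f : V →ₗ[K] W, Function.Injective f ∧ ∀ v, φ v = ψ (f v)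

/-- `φ` is weakly dominated by `ψ`: `α·φ` is dominated by `ψ` for some unit `α`. -/
def WeaklyDominated (φ : QuadraticForm K V) (ψ : QuadraticForm K W) : Prop :=
  ∃ α : Kˣ, Dominated ((α : K) • φ) ψ

/-- Witt equivalence of quadratic forms. -/
def WittEquiv (Q₁ : QuadraticForm K V) (Q₂ : QuadraticForm K W) : Prop :=
  ∃ k l : ℕ, (Q₁.prod (hypQF K k)).Equivalent (Q₂.prod (hypQF K l))

/-- `φ` is a Pfister neighbour: there is a quadratic Pfister form `π` with
`2·dim φ > dim π` and `φ ≺_w π`. -/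
def IsPfisterNeighbour (φ : QuadraticForm K V) : Prop :=
  ∃ (n : ℕ) (a : Fin n → Kˣ) (c : K),
    2 * Module.finrank K V > 2 ^ (n + 1) ∧
      WeaklyDominated φ (pfisterQF n (fun i => (a i : K)) c)

/-- The Artin–Schreier set `℘(K) = {t² + t : t ∈ K}`. -/
def ArtinSchreier (K : Type) [CommRing K] : Set K := {x : K | ∃ t : K, x = t ^ 2 + t}

end Defs

section FunField

variable (F : Type) [Field F]

/-- The coefficient matrix of a quadratic form on `Fin n → F` with respect to the
standard basis: diagonal entries `ψ(eᵢ)`, above-diagonal entries `b_ψ(eᵢ,eⱼ)`. -/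
noncomputable def coeffMat {n : ℕ} (ψ : QuadraticForm F (Fin n → F)) :
    Matrix (Fin n) (Fin n) F :=
  Matrix.of fun i j =>
    if i = j then ψ (Pi.single i 1)
    else if i < j then polar ψ (Pi.single i 1) (Pi.single j 1) else 0

/-- The homogeneous degree 2 polynomial `P_ψ` associated to a quadratic form `ψ`. -/
noncomputable def qfPoly {n : ℕ} (ψ : QuadraticForm F (Fin n → F)) :
    MvPolynomial (Fin n) F :=
  ∑ i : Fin n, ∑ j : Fin n, MvPolynomial.C (coeffMat F ψ i j) * (X i * X j)

/-- The affine coordinate ring `F[x₁,…,xₙ]/(P_ψ)` of the quadric `ψ = 0`. -/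
def FunFieldRing {n : ℕ} (ψ : QuadraticForm F (Fin n → F)) : Type :=
  MvPolynomial (Fin n) F ⧸ Ideal.span {qfPoly F ψ}

noncomputable instance {n : ℕ} (ψ : QuadraticForm F (Fin n → F)) :
    CommRing (FunFieldRing F ψ) :=
  inferInstanceAs (CommRing (MvPolynomial (Fin n) F ⧸ Ideal.span {qfPoly F ψ}))

noncomputable instance {n : ℕ} (ψ : QuadraticForm F (Fin n → F)) :
    Algebra F (FunFieldRing F ψ) :=
  inferInstanceAs (Algebra F (MvPolynomial (Fin n) F ⧸ Ideal.span {qfPoly F ψ}))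

/-- The function field `F(ψ)` of the quadric `ψ = 0`. -/
def FunField {n : ℕ} (ψ : QuadraticForm F (Fin n → F)) : Type :=
  FractionRing (FunFieldRing F ψ)

noncomputable instance {n : ℕ} (ψ : QuadraticForm F (Fin n → F)) :
    CommRing (FunField F ψ) :=
  inferInstanceAs (CommRing (FractionRing (FunFieldRing F ψ)))

noncomputable instance {n : ℕ} (ψ : QuadraticForm F (Fin n → F)) :
    Algebra (FunFieldRing F ψ) (FunField F ψ) :=
  inferInstanceAs (Algebra (FunFieldRing F ψ) (FractionRing (FunFieldRing F ψ)))

noncomputable instance {n : ℕ} (ψ : QuadraticForm F (Fin n → F)) :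
    Algebra F (FunField F ψ) :=
  inferInstanceAs (Algebra F (FractionRing (FunFieldRing F ψ)))

/-- The canonical map `F → F(ψ)`. -/
noncomputable def funFieldMap {n : ℕ} (ψ : QuadraticForm F (Fin n → F)) :
    F →+* FunField F ψ :=
  algebraMap F (FunField F ψ)

/-- Scalar extension of a quadratic form on `Fin n → F` along a ring homomorphism
`f : F → K`. -/
noncomputable def extendQF {K : Type} [CommRing K] (f : F →+* K) {n : ℕ}
    (φ : QuadraticForm F (Fin n → F)) : QuadraticForm K (Fin n → K) :=
  ((coeffMat F φ).map f).toQuadraticMap'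

end FunField


section Quat

variable (K : Type) [CommRing K]

/-- Defining relations for the char-2 quaternion algebra `[a,b)`: generators `i,j` with
`i² + i = a`, `j² = b`, `j·i = i·j + j` (i.e. `j·i·j⁻¹ = i + 1`). -/
inductive QuatRel (a b : K) : FreeAlgebra K (Fin 2) → FreeAlgebra K (Fin 2) → Prop
  | i_sq : QuatRel a b (FreeAlgebra.ι K 0 * FreeAlgebra.ι K 0 + FreeAlgebra.ι K 0)
      (algebraMap K _ a)
  | j_sq : QuatRel a b (FreeAlgebra.ι K 1 * FreeAlgebra.ι K 1) (algebraMap K _ b)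
  | swap : QuatRel a b (FreeAlgebra.ι K 1 * FreeAlgebra.ι K 0)
      (FreeAlgebra.ι K 0 * FreeAlgebra.ι K 1 + FreeAlgebra.ι K 1)

/-- The quaternion algebra `[a,b)` over `K` (characteristic two convention). -/
def QuatAlg (a b : K) : Type := RingQuot (QuatRel K a b)

noncomputable instance (a b : K) : Ring (QuatAlg K a b) :=
  inferInstanceAs (Ring (RingQuot (QuatRel K a b)))
noncomputable instance (a b : K) : Algebra K (QuatAlg K a b) :=
  inferInstanceAs (Algebra K (RingQuot (QuatRel K a b)))

/-- `[a,b)` is split over `K`: isomorphic to the `2×2` matrix algebra. -/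
def QuatSplit (a b : K) : Prop :=
  Nonempty (QuatAlg K a b ≃ₐ[K] Matrix (Fin 2) (Fin 2) K)

end Quat

section Sqrt

variable (F : Type) [Field F]

/-- The field `F(√c₁,…,√c_s)` obtained by adjoining square roots of the `cᵢ`
(inside an algebraic closure of `F`). -/
noncomputable def sqrtExt {s : ℕ} (c : Fin s → F) :
    IntermediateField F (AlgebraicClosure F) :=
  IntermediateField.adjoin F
    {y : AlgebraicClosure F | ∃ i, y ^ 2 = algebraMap F (AlgebraicClosure F) (c i)}

/-- The subfield `F² = {x² : x ∈ F}` of squares of a field of characteristic 2. -/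
noncomputable def sqSubfield : Subfield F := Subfield.closure (Set.range fun x : F => x ^ 2)

set_option synthInstance.maxHeartbeats 1000000 in
/-- The norm degree `[F²(cᵢ·cⱼ) : F²]` of a diagonal form `⟨c₁,…,c_s⟩`. -/
noncomputable def normDegree {s : ℕ} (c : Fin s → F) : ℕ :=
  Module.finrank (sqSubfield F)
    (IntermediateField.adjoin (sqSubfield F)
      (Set.range fun p : Fin s × Fin s => c p.1 * c p.2))

end Sqrt

/-- A ring is a division algebra if it is nontrivial and every nonzero element is a unit. -/
def IsDivisionAlgebra (T : Type) [Ring T] : Prop :=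
  (0 : T) ≠ 1 ∧ ∀ x : T, x ≠ 0 → IsUnit x

section PolynomialsOverDivisionRing

variable {E : Type} [DivisionRing E]

theorem Polynomial.exists_left_div (s : Polynomial E) (hs : s ≠ 0) (p : Polynomial E) :
    ∃ q r : Polynomial E, p = q * s + r ∧ r.degree < s.degree := by
  induction h : p.degree using WellFoundedLT.induction generalizing p with
  | ind d ih =>
    subst h
    by_cases hd : p.degree < s.degree
    · exact ⟨0, p, by simp, hd⟩
    push Not at hd
    have hp : p ≠ 0 := by
      rintro rfl
      simp only [Polynomial.degree_zero, le_bot_iff, Polynomial.degree_eq_bot] at hd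
      exact hs hd
    set m := Polynomial.monomial (p.natDegree - s.natDegree)
      (p.leadingCoeff * s.leadingCoeff⁻¹) with hm
    have hc : p.leadingCoeff * s.leadingCoeff⁻¹ ≠ 0 := by simp [hp, hs]
    have hdeg : (m * s).degree = p.degree := by
      rw [Polynomial.degree_mul, hm, Polynomial.degree_monomial _ hc,
        Polynomial.degree_eq_natDegree hs, Polynomial.degree_eq_natDegree hp, ← Nat.cast_add,
        Nat.sub_add_cancel (Polynomial.natDegree_le_natDegree hd)]
    have hlt : (p - m * s).degree < p.degree := by
      refine Polynomial.degree_sub_lt_left hdeg.symm hp ?_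
      rw [Polynomial.leadingCoeff_mul, hm, Polynomial.leadingCoeff_monomial, mul_assoc,
        inv_mul_cancel₀ (by simpa using hs), mul_one]
    obtain ⟨q, r, hqr, hr⟩ := ih _ hlt (p - m * s) rfl
    refine ⟨q + m, r, ?_, hr⟩
    rw [add_mul, add_right_comm, ← hqr]
    abel

theorem Polynomial.exists_left_common_multiple (s : Polynomial E) (hs : s ≠ 0)
    (p : Polynomial E) : ∃ u v : Polynomial E, u ≠ 0 ∧ u * p = v * s := by
  induction h : s.degree using WellFoundedLT.induction generalizing s p with
  | ind d ih =>
    subst h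
    obtain ⟨q, r, rfl, hr⟩ := Polynomial.exists_left_div s hs p
    by_cases hr0 : r = 0
    · exact ⟨1, q, one_ne_zero, by simp [hr0]⟩
    obtain ⟨u, v, hu, huv⟩ := ih _ hr r hr0 s rfl
    refine ⟨v, v * q + u, ?_, by rw [mul_add, add_mul, huv, mul_assoc]⟩
    rintro rfl
    rw [zero_mul] at huv
    exact (mul_ne_zero hu hs) huv

theorem Polynomial.exists_right_generator (I : AddSubgroup (Polynomial E))
    (hI : ∀ p ∈ I, ∀ q, p * q ∈ I) (hne : ∃ p ∈ I, p ≠ 0) :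
    ∃ u ∈ I, u ≠ 0 ∧ ∀ p ∈ I, ∃ q, p = u * q := by
  obtain ⟨u, ⟨huI, hu⟩, hmin⟩ := WellFounded.has_min (InvImage.wf Polynomial.degree
    (wellFounded_lt (α := WithBot ℕ))) {p | p ∈ I ∧ p ≠ 0} hne
  have hcu : (u * Polynomial.C u.leadingCoeff⁻¹).Monic :=
    Polynomial.monic_mul_leadingCoeff_inv hu
  refine ⟨u, huI, hu, fun p hp => ?_⟩
  set w := u * Polynomial.C u.leadingCoeff⁻¹ with hw
  have hdeg : w.degree = u.degree := by
    rw [hw, Polynomial.degree_mul, Polynomial.degree_C (by simpa using hu), add_zero]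
  have hdiv := Polynomial.modByMonic_add_div p w
  have hmem : p %ₘ w ∈ I := by
    have : p %ₘ w = p - w * (p /ₘ w) := by rw [eq_sub_iff_add_eq]; exact hdiv
    rw [this]
    exact I.sub_mem hp (hI _ (hI _ huI _) _)
  have hz : p %ₘ w = 0 := by
    by_contra h0
    refine hmin _ ⟨hmem, h0⟩ ?_
    change (p %ₘ w).degree < u.degree
    rw [← hdeg]
    exact Polynomial.degree_modByMonic_lt p hcu
  refine ⟨Polynomial.C u.leadingCoeff⁻¹ * (p /ₘ w), ?_⟩
  rw [← mul_assoc, ← hw]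
  rw [hz, zero_add] at hdiv
  exact hdiv.symm

/-- The division ring of left fractions of `E[t]`, by its universal features. -/
theorem Polynomial.exists_divisionRing_of_fractions (E : Type) [DivisionRing E] :
    ∃ (K : Type) (_ : DivisionRing K) (ι : Polynomial E →+* K), Function.Injective ι ∧
      ∀ z, ∃ s p, s ≠ 0 ∧ ι s * z = ι p := by
  have hore : Nonempty (OreLocalization.OreSet (nonZeroDivisors (Polynomial E))) := by
    rw [OreLocalization.nonempty_oreSet_iff_of_noZeroDivisors]
    intro r s
    obtain ⟨u, v, hu, huv⟩ :=
      Polynomial.exists_left_common_multiple s.1 (nonZeroDivisors.ne_zero s.2) r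
    exact ⟨v, ⟨u, mem_nonZeroDivisors_of_ne_zero hu⟩, huv⟩
  obtain ⟨_⟩ := hore
  refine ⟨OreLocalization (nonZeroDivisors (Polynomial E)) (Polynomial E), inferInstance,
    OreLocalization.numeratorRingHom, ?_, ?_⟩
  · exact OreLocalization.numeratorHom_inj inf_le_left
  · intro z
    induction z with | _ r s
    refine ⟨s.1, r, nonZeroDivisors.ne_zero s.2, ?_⟩
    change (s.1 /ₒ 1) * (r /ₒ s) = r /ₒ 1
    exact OreLocalization.mul_cancel

end PolynomialsOverDivisionRing

section CliffordRep

/-- The elements `a i` satisfy the relations saying that, for central scalars `c`,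
`f = ∑ cᵢ aᵢ` is a root of `f² + l(c) f + q(c)`, where `l(c) = ∑ cᵢ lᵢ` and
`q(c) = ∑ cᵢ cⱼ Qᵢⱼ`. -/
def IsCliffordRep {R ι : Type} [Ring R] (l : ι → R) (Q : ι → ι → R) (a : ι → R) : Prop :=
  (∀ i, a i * a i + l i * a i + Q i i = 0) ∧
    ∀ i j, i ≠ j → a i * a j + a j * a i + l i * a j + l j * a i + (Q i j + Q j i) = 0

variable {S K : Type} [Ring S] [DivisionRing K] {ι : S →+* K}

theorem commute_map_of_fractions (hfrac : ∀ z, ∃ s p, s ≠ 0 ∧ ι s * z = ι p)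
    (hι : Function.Injective ι) {c : S} (hc : ∀ p, Commute c p) (z : K) : Commute (ι c) z := by
  obtain ⟨s, p, hs, h⟩ := hfrac z
  have hs' : ι s ≠ 0 := by simpa using hι.ne hs
  have hz : z = (ι s)⁻¹ * ι p := by rw [← h, inv_mul_cancel_left₀ hs']
  rw [hz]
  exact (((hc s).map ι).inv_right₀).mul_right ((hc p).map ι)

/-- Elements satisfying Clifford relations over `S` stabilise a common right `S`-lattice. -/
theorem exists_stable_lattice [NoZeroDivisors S] [Nontrivial S] (hι : Function.Injective ι)
    (hfrac : ∀ z, ∃ s p, s ≠ 0 ∧ ι s * z = ι p) {κ : Type} (l : κ → S) (Q : κ → κ → S)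
    (hl : ∀ i p, Commute (l i) p) (hQ : ∀ i j p, Commute (Q i j) p) (a : κ → K)
    (ha : IsCliffordRep (fun i => ι (l i)) (fun i j => ι (Q i j)) a) (T : Finset κ) :
    ∃ M : AddSubgroup K, 1 ∈ M ∧ (∀ x ∈ M, ∀ p, x * ι p ∈ M) ∧
      (∃ s, s ≠ 0 ∧ ∀ x ∈ M, ∃ p, ι s * x = ι p) ∧ ∀ i ∈ T, ∀ x ∈ M, a i * x ∈ M := by
  classical
  induction T using Finset.induction with
  | empty =>
    refine ⟨ι.range.toAddSubgroup, ⟨1, map_one ι⟩, ?_, ⟨1, one_ne_zero, ?_⟩, by simp⟩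
    · rintro _ ⟨q, rfl⟩ p
      exact ⟨q * p, map_mul ..⟩
    · rintro _ ⟨q, rfl⟩
      exact ⟨q, by simp⟩
  | insert j T hj ih =>
    obtain ⟨M, h1, hM, ⟨s, hs, hsM⟩, hT⟩ := ih
    have hs' : ι s ≠ 0 := by simpa using hι.ne hs
    have hleft : ∀ c : S, (∀ p, Commute c p) → ∀ x ∈ M, ι c * x ∈ M := fun c hc x hx => by
      rw [(commute_map_of_fractions hfrac hι hc x).eq]
      exact hM x hx c
    have hmem : ∀ z, z ∈ M ⊔ M.map (AddMonoidHom.mulLeft (a j)) ↔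
        ∃ x ∈ M, ∃ y ∈ M, x + a j * y = z := by
      intro z
      simp [AddSubgroup.mem_sup]
    refine ⟨M ⊔ M.map (AddMonoidHom.mulLeft (a j)), AddSubgroup.mem_sup_left h1, ?_, ?_, ?_⟩
    · intro z hz p
      rw [hmem] at hz ⊢
      obtain ⟨x, hx, y, hy, rfl⟩ := hz
      exact ⟨x * ι p, hM x hx p, y * ι p, hM y hy p, by rw [add_mul, mul_assoc]⟩
    · obtain ⟨r, p, hr, hrp⟩ := hfrac (ι s * a j * (ι s)⁻¹)
      refine ⟨r * s, mul_ne_zero hr hs, fun z hz => ?_⟩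
      rw [hmem] at hz
      obtain ⟨x, hx, y, hy, rfl⟩ := hz
      obtain ⟨p₁, hp₁⟩ := hsM x hx
      obtain ⟨p₂, hp₂⟩ := hsM y hy
      refine ⟨r * p₁ + p * p₂, ?_⟩
      have : ι s * (a j * y) = (ι s * a j * (ι s)⁻¹) * (ι s * y) := by
        simp only [mul_assoc, inv_mul_cancel_left₀ hs']
      rw [mul_add, map_mul, mul_assoc, mul_assoc, hp₁, this, hp₂, ← mul_assoc (ι r), hrp]
      simp
    · intro i hi z hz
      rw [hmem] at hz ⊢
      obtain ⟨x, hx, y, hy, rfl⟩ := hz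
      by_cases hij : i = j
      · subst hij
        refine ⟨-(ι (Q i i) * y), M.neg_mem (hleft _ (hQ i i) _ hy), x - ι (l i) * y,
          M.sub_mem hx (hleft _ (hl i) _ hy), ?_⟩
        have h := ha.1 i
        have hc := (commute_map_of_fractions hfrac hι (hl i) (a i)).eq
        have h2 : a i * (a i * y) = -(a i * (ι (l i) * y)) - ι (Q i i) * y := by
          rw [← mul_assoc, ← mul_assoc, ← hc]
          refine sub_eq_zero.1 (Eq.trans ?_ ((congrArg (· * y) h).trans (zero_mul y)))
          noncomm_ring
        rw [mul_add, mul_sub, h2]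
        abel
      · have hiT : i ∈ T := (Finset.mem_insert.1 hi).resolve_left hij
        have h := ha.2 i j hij
        have hc := (commute_map_of_fractions hfrac hι (hl i) (a j)).eq
        have hcc : ∀ p, Commute (Q i j + Q j i) p := fun p => (hQ i j p).add_left (hQ j i p)
        refine ⟨a i * x - ι (l j) * (a i * y) - ι (Q i j + Q j i) * y,
          M.sub_mem (M.sub_mem (hT i hiT x hx) (hleft _ (hl j) _ (hT i hiT y hy)))
            (hleft _ hcc _ hy),
          -(a i * y) - ι (l i) * y,
          M.sub_mem (M.neg_mem (hT i hiT y hy)) (hleft _ (hl i) _ hy), ?_⟩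
        have h2 : a i * (a j * y) = -(a j * (a i * y)) - a j * (ι (l i) * y)
            - ι (l j) * (a i * y) - ι (Q i j + Q j i) * y := by
          rw [map_add]
          simp only [← mul_assoc]
          rw [← hc]
          refine sub_eq_zero.1 (Eq.trans ?_ ((congrArg (· * y) h).trans (zero_mul y)))
          noncomm_ring
        rw [mul_add, mul_sub, mul_neg, h2]
        abel

/-- Over a division ring of fractions of `E[t]`, a solution of Clifford relations with coefficients
in `E[t]` is conjugate to a solution in `E[t]`. -/
theorem exists_integral_rep {E K : Type} [DivisionRing E] [DivisionRing K]
    {ι : Polynomial E →+* K} (hι : Function.Injective ι)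
    (hfrac : ∀ z, ∃ s p, s ≠ 0 ∧ ι s * z = ι p) {κ : Type} [Fintype κ] (l : κ → Polynomial E)
    (Q : κ → κ → Polynomial E)
    (hl : ∀ i p, Commute (l i) p) (hQ : ∀ i j p, Commute (Q i j) p) (a : κ → K)
    (ha : IsCliffordRep (fun i => ι (l i)) (fun i j => ι (Q i j)) a) :
    ∃ b : κ → Polynomial E, IsCliffordRep l Q b := by
  obtain ⟨M, h1, hM, ⟨s, hs, hsM⟩, hT⟩ :=
    exists_stable_lattice hι hfrac l Q hl hQ a ha Finset.univ
  have hs' : ι s ≠ 0 := by simpa using hι.ne hs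
  obtain ⟨u, huI, hu, hgen⟩ := Polynomial.exists_right_generator
    ((M.map (AddMonoidHom.mulLeft (ι s))).comap ι.toAddMonoidHom) (by
      rintro p ⟨x, hx, hxp⟩ q
      refine ⟨x * ι q, hM x hx q, ?_⟩
      simp only [AddMonoidHom.coe_mulLeft] at hxp ⊢
      rw [← mul_assoc, hxp]
      simp) ⟨s, ⟨1, h1, by simp⟩, hs⟩
  obtain ⟨w, hw, hwu⟩ := huI
  simp only [AddMonoidHom.coe_mulLeft] at hwu
  change ι s * w = ι u at hwu
  have hw0 : w ≠ 0 := by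
    rintro rfl
    rw [mul_zero] at hwu
    exact hu (hι (by rw [← hwu, map_zero]))
  have key : ∀ i, ∃ p, a i * w = w * ι p := by
    intro i
    have hmem := hT i (Finset.mem_univ i) w hw
    obtain ⟨p, hp⟩ := hsM _ hmem
    obtain ⟨q, rfl⟩ := hgen p ⟨_, hmem, hp⟩
    refine ⟨q, mul_left_cancel₀ hs' ?_⟩
    rw [hp, map_mul, ← hwu, mul_assoc]
  choose b hb using key
  have hconj : ∀ i, ι (b i) = w⁻¹ * a i * w := fun i => by
    rw [mul_assoc, hb, inv_mul_cancel_left₀ hw0]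
  have hcen : ∀ c : Polynomial E, (∀ p, Commute c p) → ι c = w⁻¹ * ι c * w := fun c hc => by
    rw [mul_assoc, (commute_map_of_fractions hfrac hι hc w).eq, inv_mul_cancel_left₀ hw0]
  have hmul : ∀ x y, w⁻¹ * x * w * (w⁻¹ * y * w) = w⁻¹ * (x * y) * w := fun x y => by
    simp only [mul_assoc, mul_inv_cancel_left₀ hw0]
  refine ⟨b, fun i => hι ?_, fun i j hij => hι ?_⟩
  · simp only [map_add, map_mul, map_zero]
    rw [hcen _ (hl i), hcen _ (hQ i i), hconj, hmul, hmul, ← add_mul, ← add_mul, ← mul_add,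
      ← mul_add, ha.1 i, mul_zero, zero_mul]
  · simp only [map_add, map_mul, map_zero]
    rw [hcen _ (hl i), hcen _ (hl j), hcen _ (hQ i j), hcen _ (hQ j i), hconj, hconj, hmul, hmul,
      hmul, hmul]
    simp only [← add_mul, ← mul_add]
    rw [ha.2 i j hij, mul_zero, zero_mul]

end CliffordRep

section GenericPoint

variable {E : Type} [DivisionRing E]

theorem Polynomial.natDegree_le_of_monic_quadratic {p L N : Polynomial E} {d : ℕ}
    (h : p * p + L * p + N = 0) (hL : L.natDegree ≤ d) (hN : N.natDegree ≤ 2 * d) :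
    p.natDegree ≤ d := by
  by_contra! hd
  have hp : p ≠ 0 := by
    rintro rfl
    simp at hd
  have h1 : p * p = -(L * p + N) := by
    rw [eq_neg_iff_add_eq_zero, ← add_assoc, h]
  have h2 := congrArg Polynomial.natDegree h1
  rw [Polynomial.natDegree_mul hp hp, Polynomial.natDegree_neg] at h2
  have h3 := Polynomial.natDegree_add_le (L * p) N
  have h4 := Polynomial.natDegree_mul_le (p := L) (q := p)
  omega

/-- The linear coefficients obtained by evaluating the first two coordinates at `1` and `t`. -/
noncomputable def mergeLin {m : ℕ} (l : Fin (m + 2) → E) : Fin (m + 1) → Polynomial E :=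
  Fin.cons (Polynomial.C (l 0) + Polynomial.X * Polynomial.C (l 1))
    fun i => Polynomial.C (l i.succ.succ)

/-- The quadratic coefficients obtained by evaluating the first two coordinates at `1` and `t`. -/
noncomputable def mergeQuad {m : ℕ} (Q : Fin (m + 2) → Fin (m + 2) → E) :
    Fin (m + 1) → Fin (m + 1) → Polynomial E :=
  Fin.cons
    (Fin.cons (Polynomial.C (Q 0 0) + Polynomial.X * Polynomial.C (Q 0 1 + Q 1 0)
        + Polynomial.X * Polynomial.X * Polynomial.C (Q 1 1))
      fun k => Polynomial.C (Q 0 k.succ.succ) + Polynomial.X * Polynomial.C (Q 1 k.succ.succ))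
    fun i => Fin.cons
      (Polynomial.C (Q i.succ.succ 0) + Polynomial.X * Polynomial.C (Q i.succ.succ 1))
      fun k => Polynomial.C (Q i.succ.succ k.succ.succ)

theorem Polynomial.commute_C_of_central {c : E} (hc : ∀ e, Commute c e) (p : Polynomial E) :
    Commute (Polynomial.C c) p := by
  refine Polynomial.ext fun n => ?_
  rw [Polynomial.coeff_C_mul, Polynomial.coeff_mul_C, (hc _).eq]

theorem mergeLin_central {m : ℕ} {l : Fin (m + 2) → E} (hl : ∀ i e, Commute (l i) e) (i)
    (p : Polynomial E) : Commute (mergeLin l i) p := by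
  have h := fun i => Polynomial.commute_C_of_central (hl i) p
  have hX : Commute Polynomial.X p := Polynomial.commute_X p
  refine Fin.cases ?_ (fun i => ?_) i
  · exact (h 0).add_left (hX.mul_left (h 1))
  · exact h _

theorem mergeQuad_central {m : ℕ} {Q : Fin (m + 2) → Fin (m + 2) → E}
    (hQ : ∀ i k e, Commute (Q i k) e) (i k) (p : Polynomial E) : Commute (mergeQuad Q i k) p := by
  have h := fun i k => Polynomial.commute_C_of_central (hQ i k) p
  have h01 := Polynomial.commute_C_of_central (fun e => (hQ 0 1 e).add_left (hQ 1 0 e)) p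
  have hX : Commute Polynomial.X p := Polynomial.commute_X p
  refine Fin.cases ?_ (fun i => ?_) i <;> refine Fin.cases ?_ (fun k => ?_) k
  · exact ((h 0 0).add_left (hX.mul_left h01)).add_left ((hX.mul_left hX).mul_left (h 1 1))
  · exact (h 0 _).add_left (hX.mul_left (h 1 _))
  · exact (h _ 0).add_left (hX.mul_left (h _ 1))
  · exact h _ _

theorem linear_mul_linear {R : Type} [Ring R] {t : R} (ht : ∀ p, Commute t p) (α β α' β' : R) :
    (α + t * β) * (α' + t * β') = α * α' + t * (α * β' + β * α') + t * t * (β * β') := by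
  have h1 : α * (t * β') = t * (α * β') := by rw [← mul_assoc, ← (ht α).eq, mul_assoc]
  have h2 : t * β * (t * β') = t * t * (β * β') := by
    rw [mul_assoc, ← mul_assoc β, ← (ht β).eq, mul_assoc, mul_assoc]
  rw [add_mul, mul_add, mul_add, h1, h2]
  noncomm_ring

theorem exists_rep_of_merge {m : ℕ} {l : Fin (m + 2) → E} {Q : Fin (m + 2) → Fin (m + 2) → E}
    {b : Fin (m + 1) → Polynomial E} (hb : IsCliffordRep (mergeLin l) (mergeQuad Q) b) :
    ∃ a, IsCliffordRep l Q a := by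
  obtain ⟨hb1, hb2⟩ := hb
  have hd0 : (b 0).natDegree ≤ 1 := by
    refine Polynomial.natDegree_le_of_monic_quadratic (hb1 0) ?_ ?_
    · simp only [mergeLin, Fin.cons_zero]
      compute_degree
    · simp only [mergeQuad, Fin.cons_zero]
      compute_degree
  have hd : ∀ i : Fin m, (b i.succ).natDegree ≤ 0 := by
    intro i
    refine Polynomial.natDegree_le_of_monic_quadratic (hb1 i.succ) ?_ ?_
    · simp [mergeLin]
    · simp [mergeQuad]
  obtain ⟨α, β, h0⟩ : ∃ α β, b 0 = Polynomial.C α + Polynomial.X * Polynomial.C β := by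
    refine ⟨(b 0).coeff 0, (b 0).coeff 1, ?_⟩
    rw [Polynomial.X_mul_C]
    conv_lhs => rw [Polynomial.eq_X_add_C_of_natDegree_le_one hd0]
    rw [add_comm]
  choose γ hγ using fun i => (⟨_, Polynomial.eq_C_of_natDegree_le_zero (hd i)⟩ :
    ∃ c, b (Fin.succ i) = Polynomial.C c)
  have split1 : ∀ {u v : E}, Polynomial.C u + Polynomial.X * Polynomial.C v = 0 →
      u = 0 ∧ v = 0 := by
    intro u v h
    have h0 := congrArg (Polynomial.coeff · 0) h
    have h1 := congrArg (Polynomial.coeff · 1) h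
    simp at h0 h1
    exact ⟨h0, h1⟩
  have split2 : ∀ {u v w : E}, Polynomial.C u + Polynomial.X * Polynomial.C v
      + Polynomial.X * Polynomial.X * Polynomial.C w = 0 → u = 0 ∧ v = 0 ∧ w = 0 := by
    intro u v w h
    rw [← pow_two] at h
    have h0 := congrArg (Polynomial.coeff · 0) h
    have h1 := congrArg (Polynomial.coeff · 1) h
    have h2 := congrArg (Polynomial.coeff · 2) h
    simp [Polynomial.coeff_X, Polynomial.coeff_C] at h0 h1 h2
    exact ⟨h0, h1, h2⟩
  have hX : ∀ p : Polynomial E, Commute Polynomial.X p := Polynomial.commute_X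
  have mulC : ∀ u v w : E, (Polynomial.C u + Polynomial.X * Polynomial.C v) * Polynomial.C w =
      Polynomial.C (u * w) + Polynomial.X * Polynomial.C (v * w) := by
    intro u v w
    simp only [add_mul, map_mul, mul_assoc]
  have Cmul : ∀ u v w : E, Polynomial.C w * (Polynomial.C u + Polynomial.X * Polynomial.C v) =
      Polynomial.C (w * u) + Polynomial.X * Polynomial.C (w * v) := by
    intro u v w
    simp only [mul_add, map_mul, ← mul_assoc, (hX (Polynomial.C w)).eq]
  have key0 := hb1 0
  simp only [mergeLin, mergeQuad, Fin.cons_zero, h0, linear_mul_linear hX, ← map_mul,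
    ← map_add] at key0
  obtain ⟨k00, k01, k11⟩ := split2 (u := α * α + l 0 * α + Q 0 0)
    (v := α * β + β * α + (l 0 * β + l 1 * α) + (Q 0 1 + Q 1 0))
    (w := β * β + l 1 * β + Q 1 1) (by rw [← key0]; simp only [map_add]; noncomm_ring)
  have keyi := fun i : Fin m => hb1 i.succ
  simp only [mergeLin, mergeQuad, Fin.cons_succ, hγ, ← map_mul, ← map_add,
    Polynomial.C_eq_zero] at keyi
  have keyij := fun (i k : Fin m) (h : i ≠ k) =>
    hb2 i.succ k.succ (by simpa using h)
  simp only [mergeLin, mergeQuad, Fin.cons_succ, hγ, ← map_mul, ← map_add,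
    Polynomial.C_eq_zero] at keyij
  have key0i := fun i : Fin m => hb2 0 i.succ (Fin.succ_ne_zero i).symm
  simp only [mergeLin, mergeQuad, Fin.cons_succ, Fin.cons_zero, h0, hγ, mulC, Cmul] at key0i
  have k0i : ∀ i : Fin m, _ := fun i : Fin m =>
    split1 (u := α * γ i + γ i * α + l 0 * γ i + l i.succ.succ * α +
        (Q 0 i.succ.succ + Q i.succ.succ 0))
      (v := β * γ i + γ i * β + l 1 * γ i + l i.succ.succ * β +
        (Q 1 i.succ.succ + Q i.succ.succ 1))
      (by rw [← key0i i]; simp only [map_add]; noncomm_ring)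
  have hsymm : ∀ {u v x y s t : E}, u + v + x + y + (s + t) = 0 → v + u + y + x + (t + s) = 0 := by
    intro u v x y s t h
    rw [← h]
    abel
  have k01' : α * β + β * α + l 0 * β + l 1 * α + (Q 0 1 + Q 1 0) = 0 := by
    rw [← k01]
    abel
  refine ⟨Fin.cons α (Fin.cons β γ), fun i => ?_, fun i k hik => ?_⟩
  · refine Fin.cases k00 (fun i => ?_) i
    exact Fin.cases k11 keyi i
  · revert hik
    refine Fin.cases ?_ (fun i => Fin.cases ?_ (fun i => ?_) i) i <;>
      refine Fin.cases ?_ (fun k => Fin.cases ?_ (fun k => ?_) k) k <;> intro hik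
    · exact absurd rfl hik
    · exact k01'
    · exact (k0i k).1
    · exact hsymm k01'
    · exact absurd rfl hik
    · exact (k0i k).2
    · exact hsymm (k0i i).1
    · exact hsymm (k0i i).2
    · exact keyij i k (by simpa using hik)

/-- Adjoining `m` independent central variables to a division ring `E`, in such a way that a root
of a quadratic polynomial at the generic point `(1, x₁, …, xₘ)` yields a solution over `E` of the
corresponding Clifford relations. -/
theorem exists_generic_extension (m : ℕ) (E : Type) [DivisionRing E] :
    ∃ (K : Type) (_ : DivisionRing K) (j : E →+* K) (x : Fin m → Subring.center K),
      (∀ c, (∀ e, Commute c e) → ∀ z, Commute (j c) z) ∧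
      (∀ c : (Fin m →₀ ℕ) →₀ E,
        (c.sum fun α e => j e * ((α.prod fun i k => x i ^ k : Subring.center K) : K)) = 0 →
          c = 0) ∧
      ∀ (l : Fin (m + 1) → E) (Q : Fin (m + 1) → Fin (m + 1) → E),
        (∀ i e, Commute (l i) e) → (∀ i k e, Commute (Q i k) e) → ∀ θ : K,
        θ * θ + (∑ i, j (l i) * Fin.cons (α := fun _ => K) 1 (fun i => (x i : K)) i) * θ +
          ∑ i, ∑ k, j (Q i k) * (Fin.cons (α := fun _ => K) 1 (fun i => (x i : K)) i *
            Fin.cons (α := fun _ => K) 1 (fun i => (x i : K)) k) = 0 →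
        ∃ a, IsCliffordRep l Q a := by
  induction m generalizing E with
  | zero =>
    refine ⟨E, inferInstance, RingHom.id E, Fin.elim0, fun c hc => hc, fun c hc => ?_, ?_⟩
    · have h0 : c = Finsupp.single 0 (c 0) := Finsupp.ext fun α => by
        rw [Subsingleton.elim α 0, Finsupp.single_eq_same]
      rw [h0, Finsupp.sum_single_index (by simp)] at hc
      rw [h0]
      simpa using hc
    · intro l Q _ _ θ hθ
      refine ⟨fun _ => θ, fun i => ?_, fun i k hik => absurd (by omega) hik⟩
      obtain rfl : i = 0 := by omega
      simpa using hθ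
  | succ m ih =>
    obtain ⟨E₁, _, ι, hι, hfrac⟩ := Polynomial.exists_divisionRing_of_fractions E
    obtain ⟨K, _, j, x, hcen, hind, hrep⟩ := ih E₁
    have hXc : ∀ z, Commute (j (ι Polynomial.X)) z :=
      hcen _ (commute_map_of_fractions hfrac hι Polynomial.commute_X)
    refine ⟨K, inferInstance, j.comp (ι.comp Polynomial.C),
      Fin.cons ⟨j (ι Polynomial.X), Subring.mem_center_iff.2 fun z => (hXc z).eq.symm⟩ x, ?_, ?_, ?_⟩
    · exact fun c hc => hcen _ (commute_map_of_fractions hfrac hι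
        (Polynomial.commute_C_of_central hc))
    · intro c hc
      let g (α : Fin (m + 1) →₀ ℕ) (e : E) : (Fin m →₀ ℕ) →₀ E₁ :=
        Finsupp.single α.tail (ι (Polynomial.monomial (α 0) e))
      have hg : c.sum g = 0 := by
        refine hind _ ?_
        rw [Finsupp.sum_sum_index (by simp) (by simp [add_mul]), ← hc]
        refine Finset.sum_congr rfl fun α _ => ?_
        simp only [g]
        rw [Finsupp.sum_single_index (by simp), Finsupp.prod_fintype _ _ (by simp),
          Finsupp.prod_fintype _ _ (by simp), Fin.prod_univ_succ,
          ← Polynomial.C_mul_X_pow_eq_monomial]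
        simp [Finsupp.tail_apply, mul_assoc]
      refine Finsupp.ext fun α => ?_
      have h1 := DFunLike.congr_fun hg α.tail
      rw [Finsupp.sum_apply, Finsupp.sum] at h1
      simp only [g, Finsupp.single_apply, Finsupp.coe_zero, Pi.zero_apply] at h1
      have h2 : ι (∑ β ∈ c.support, if β.tail = α.tail then Polynomial.monomial (β 0) (c β) else 0)
          = 0 := by
        rw [← h1, map_sum]
        exact Finset.sum_congr rfl fun β _ => by split_ifs <;> simp
      rw [map_eq_zero_iff _ hι] at h2
      have h3 := congrArg (Polynomial.coeff · (α 0)) h2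
      simp only [Polynomial.finsetSum_coeff, Polynomial.coeff_zero] at h3
      rw [Finset.sum_eq_single α] at h3
      · simpa using h3
      · intro β _ hβ
        split_ifs with ht
        · rw [Polynomial.coeff_monomial, if_neg]
          intro h0
          refine hβ ?_
          rw [← Finsupp.cons_tail β, ← Finsupp.cons_tail α, ht, h0]
        · simp
      · intro hα
        simpa using hα
    · intro l Q hl hQ θ hθ
      obtain ⟨a, ha⟩ := hrep (fun i => ι (mergeLin l i)) (fun i k => ι (mergeQuad Q i k))
        (fun i => commute_map_of_fractions hfrac hι (mergeLin_central hl i))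
        (fun i k => commute_map_of_fractions hfrac hι (mergeQuad_central hQ i k)) θ (by
          rw [← hθ]
          have h1 := fun c => (hXc (j (ι (Polynomial.C c)))).eq
          have h1' := fun c z => (hXc (j (ι (Polynomial.C c)))).left_comm z
          have h2 := fun i => (hXc (x i)).eq
          refine congrArg₂ (· + ·) (congrArg (fun s => θ * θ + s * θ) ?_) ?_
          · simp only [mergeLin, Fin.sum_univ_succ, Fin.cons_zero, Fin.cons_succ, map_add, map_mul,
              RingHom.comp_apply, h1, mul_one, ← add_assoc, Fin.succ_zero_eq_one]
          · simp only [mergeQuad, Fin.sum_univ_succ, Fin.cons_zero, Fin.cons_succ, map_add,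
              map_mul, RingHom.comp_apply, h1, h1', add_mul, mul_add, mul_one, one_mul,
              Fin.succ_zero_eq_one, mul_assoc, h2, Finset.sum_add_distrib]
            abel)
      obtain ⟨b, hb⟩ := exists_integral_rep hι hfrac _ _ (mergeLin_central hl)
        (mergeQuad_central hQ) a ha
      exact exists_rep_of_merge hb

end GenericPoint

section CliffordKernel

variable {F B D κ : Type} [Field F] [CharP F 2] [Ring B] [Algebra F B] [DivisionRing D]
  [Algebra F D]

theorem add_self_eq_zero_of_charTwo (F : Type) {B : Type} [Field F] [CharP F 2] [Ring B]
    [Algebra F B] (x : B) : x + x = 0 := by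
  rw [← two_mul, ← map_ofNat (algebraMap F B) 2, CharTwo.two_eq_zero, map_zero, zero_mul]

/-- Algebra morphisms to a division ring are injective on the span of the monomials in a family of
commuting quaternionic pairs `E i`, `G i` and a generator `z` of a separable quadratic extension. -/
theorem exists_stable_submodule_injective (φ : B →ₐ[F] D) {z : B} {c : F}
    (hz : z * z + z = algebraMap F B c) (hc : c ∉ ArtinSchreier F) (E G : κ → B)
    (hE : ∀ i, ∃ e : F, E i * E i = algebraMap F B e)
    (hG : ∀ i, ∃ e : F, G i * G i = algebraMap F B e)
    (hEG : ∀ i, G i * E i = 1 + E i * G i)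
    (hEE : ∀ i j, i ≠ j → Commute (E i) (E j)) (hGG : ∀ i j, i ≠ j → Commute (G i) (G j))
    (hEG' : ∀ i j, i ≠ j → Commute (E i) (G j))
    (hEz : ∀ i, Commute (E i) z) (hGz : ∀ i, Commute (G i) z) (S : Finset κ) :
    ∃ T : Submodule F B, 1 ∈ T ∧ (∀ x ∈ T, z * x ∈ T) ∧
      (∀ i ∈ S, ∀ x ∈ T, E i * x ∈ T ∧ G i * x ∈ T) ∧
      (∀ y, Commute y z → (∀ i ∈ S, Commute y (E i) ∧ Commute y (G i)) → ∀ x ∈ T, Commute y x) ∧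
      ∀ x ∈ T, φ x = 0 → x = 0 := by
  classical
  have h2 : ∀ x : B, x + x = 0 := add_self_eq_zero_of_charTwo F
  induction S using Finset.induction with
  | empty =>
    refine ⟨Submodule.span F {1, z}, Submodule.subset_span (by simp), ?_, by simp, ?_, ?_⟩
    · intro x hx
      obtain ⟨u, v, rfl⟩ := Submodule.mem_span_pair.1 hx
      refine Submodule.mem_span_pair.2 ⟨v * c, u - v, ?_⟩
      rw [mul_smul, ← Algebra.algebraMap_eq_smul_one, ← hz, mul_add, mul_smul_comm, mul_smul_comm,
        mul_one, sub_smul, smul_add]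
      abel
    · intro y hy _ x hx
      obtain ⟨u, v, rfl⟩ := Submodule.mem_span_pair.1 hx
      exact ((Commute.one_right y).smul_right u).add_right (hy.smul_right v)
    · intro x hx hφ
      obtain ⟨u, v, rfl⟩ := Submodule.mem_span_pair.1 hx
      have hv : v = 0 := by
        by_contra hv
        have h1 : φ z = algebraMap F D (-(v⁻¹ * u)) := by
          simp only [map_add, map_smul, map_one] at hφ
          have h3 : v⁻¹ • (u • (1 : D) + v • φ z) = 0 := by rw [hφ, smul_zero]
          rw [smul_add, smul_smul, smul_smul, inv_mul_cancel₀ hv, one_smul] at h3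
          rw [map_neg, Algebra.algebraMap_eq_smul_one, eq_neg_iff_add_eq_zero, add_comm, h3]
        have h4 := congrArg φ hz
        simp only [map_add, map_mul, h1, AlgHom.commutes] at h4
        rw [← map_mul, ← map_add] at h4
        exact hc ⟨_, by rw [pow_two]; exact ((algebraMap F D).injective h4).symm⟩
      subst hv
      simp only [zero_smul, add_zero, map_smul, map_one, smul_eq_zero, one_ne_zero, or_false] at hφ
      simp [hφ]
  | insert i S hi ih =>
    obtain ⟨T, h1, hzT, hST, hcom, hinj⟩ := ih
    obtain ⟨e, he⟩ := hE i
    obtain ⟨g, hg⟩ := hG i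
    have hne : ∀ j ∈ S, i ≠ j := fun j hj h => hi (h ▸ hj)
    have cE : ∀ x ∈ T, E i * x = x * E i := fun x hx => hcom _ (hEz i)
      (fun j hj => ⟨hEE i j (hne j hj), hEG' i j (hne j hj)⟩) x hx
    have cG : ∀ x ∈ T, G i * x = x * G i := fun x hx => hcom _ (hGz i)
      (fun j hj => ⟨(hEG' j i (hne j hj).symm).symm, hGG i j (hne j hj)⟩) x hx
    have cE' : ∀ x ∈ T, ∀ y, E i * (x * y) = x * (E i * y) := fun x hx y => by
      rw [← mul_assoc, cE x hx, mul_assoc]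
    have cG' : ∀ x ∈ T, ∀ y, G i * (x * y) = x * (G i * y) := fun x hx y => by
      rw [← mul_assoc, cG x hx, mul_assoc]
    have hEE' : E i * (E i * G i) = e • G i := by rw [← mul_assoc, he, Algebra.smul_def]
    have hGEG : G i * (E i * G i) = G i + g • E i := by
      rw [← mul_assoc, hEG, add_mul, one_mul, mul_assoc, hg, Algebra.smul_def, Algebra.commutes]
    have he' : E i * E i = e • 1 := by rw [he, Algebra.algebraMap_eq_smul_one]
    have hg' : G i * G i = g • 1 := by rw [hg, Algebra.algebraMap_eq_smul_one]
    let T' : Submodule F B :=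
      { carrier := {x | ∃ α ∈ T, ∃ β ∈ T, ∃ γ ∈ T, ∃ δ ∈ T,
          x = α + β * E i + γ * G i + δ * (E i * G i)}
        zero_mem' := ⟨0, T.zero_mem, 0, T.zero_mem, 0, T.zero_mem, 0, T.zero_mem, by simp⟩
        add_mem' := by
          rintro _ _ ⟨α, hα, β, hβ, γ, hγ, δ, hδ, rfl⟩ ⟨α', hα', β', hβ', γ', hγ', δ', hδ', rfl⟩
          refine ⟨α + α', T.add_mem hα hα', β + β', T.add_mem hβ hβ', γ + γ', T.add_mem hγ hγ',
            δ + δ', T.add_mem hδ hδ', ?_⟩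
          simp only [add_mul]
          abel
        smul_mem' := by
          rintro r _ ⟨α, hα, β, hβ, γ, hγ, δ, hδ, rfl⟩
          refine ⟨r • α, T.smul_mem r hα, r • β, T.smul_mem r hβ, r • γ, T.smul_mem r hγ,
            r • δ, T.smul_mem r hδ, ?_⟩
          simp only [smul_add, smul_mul_assoc] }
    have hleft : ∀ y : B, (∀ x ∈ T, y * x ∈ T) → ∀ x ∈ T', y * x ∈ T' := by
      rintro y hy _ ⟨α, hα, β, hβ, γ, hγ, δ, hδ, rfl⟩
      exact ⟨_, hy α hα, _, hy β hβ, _, hy γ hγ, _, hy δ hδ, by simp only [mul_add, mul_assoc]⟩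
    refine ⟨T', ⟨1, h1, 0, T.zero_mem, 0, T.zero_mem, 0, T.zero_mem, by simp⟩, hleft z hzT, ?_, ?_,
      ?_⟩
    · intro j hj x hx
      rcases Finset.mem_insert.1 hj with rfl | hj
      · obtain ⟨α, hα, β, hβ, γ, hγ, δ, hδ, rfl⟩ := hx
        constructor
        · refine ⟨e • β, T.smul_mem _ hβ, α, hα, e • δ, T.smul_mem _ hδ, γ, hγ, ?_⟩
          simp only [mul_add, cE α hα, cE' β hβ, cE' γ hγ, cE' δ hδ, he', hEE', mul_smul_comm,
            smul_mul_assoc, mul_one]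
          abel
        · refine ⟨g • γ + β, T.add_mem (T.smul_mem _ hγ) hβ, g • δ, T.smul_mem _ hδ, α + δ,
            T.add_mem hα hδ, β, hβ, ?_⟩
          simp only [mul_add, cG α hα, cG' β hβ, cG' γ hγ, cG' δ hδ, hg', hGEG, hEG, mul_smul_comm,
            smul_mul_assoc, mul_one, add_mul]
          abel
      · exact ⟨hleft _ (fun x hx => (hST j hj x hx).1) x hx,
          hleft _ (fun x hx => (hST j hj x hx).2) x hx⟩
    · rintro y hyz hy _ ⟨α, hα, β, hβ, γ, hγ, δ, hδ, rfl⟩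
      have hT := hcom y hyz fun j hj => hy j (Finset.mem_insert_of_mem hj)
      obtain ⟨hyE, hyG⟩ := hy i (Finset.mem_insert_self i S)
      exact (((hT α hα).add_right ((hT β hβ).mul_right hyE)).add_right
        ((hT γ hγ).mul_right hyG)).add_right ((hT δ hδ).mul_right (hyE.mul_right hyG))
    · rintro _ ⟨α, hα, β, hβ, γ, hγ, δ, hδ, rfl⟩ hφ
      have bracket : ∀ {x} y, φ x = 0 → φ (y * x - x * y) = 0 := by
        intro x y h
        rw [map_sub, map_mul, map_mul, h, mul_zero, zero_mul, sub_zero]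
      have b1 : ∀ α ∈ T, ∀ β ∈ T, ∀ γ ∈ T, ∀ δ ∈ T, G i * (α + β * E i + γ * G i + δ * (E i * G i)) -
          (α + β * E i + γ * G i + δ * (E i * G i)) * G i = β + δ * G i := by
        intro α hα β hβ γ hγ δ hδ
        simp only [mul_add, cG α hα, cG' β hβ, cG' γ hγ, cG' δ hδ, hg', hGEG, hEG, mul_smul_comm,
          mul_one, add_mul, mul_assoc]
        abel
      have b2 : ∀ β ∈ T, ∀ δ ∈ T, E i * (β + δ * G i) - (β + δ * G i) * E i = -δ := by
        intro β hβ δ hδ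
        simp only [mul_add, add_mul, cE β hβ, cE' δ hδ, mul_assoc, hEG, mul_one]
        abel
      have d1 := bracket (G i) hφ
      rw [b1 α hα β hβ γ hγ δ hδ] at d1
      have d2 := bracket (E i) d1
      rw [b2 β hβ δ hδ, map_neg, neg_eq_zero] at d2
      obtain rfl := hinj δ hδ d2
      rw [zero_mul, add_zero] at d1
      obtain rfl := hinj β hβ d1
      have d3 := bracket (E i) hφ
      have b3 : E i * (α + 0 * E i + γ * G i + 0 * (E i * G i)) -
          (α + 0 * E i + γ * G i + 0 * (E i * G i)) * E i = -γ := by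
        simp only [zero_mul, add_zero]
        exact b2 α hα γ hγ
      rw [b3, map_neg, neg_eq_zero] at d3
      obtain rfl := hinj γ hγ d3
      simp only [zero_mul, add_zero] at hφ ⊢
      exact hinj α hα hφ

end CliffordKernel

section EvenInjective

variable {F V D κ : Type} [Field F] [CharP F 2] [AddCommGroup V] [Module F V]

theorem CliffordAlgebra.ι_mul_ι_swap_of_charTwo (ψ : QuadraticForm F V) (v w : V) :
    CliffordAlgebra.ι ψ w * CliffordAlgebra.ι ψ v =
      CliffordAlgebra.ι ψ v * CliffordAlgebra.ι ψ w + algebraMap F _ (polar ψ v w) := by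
  rw [← CliffordAlgebra.ι_mul_ι_add_swap, ← add_assoc, add_self_eq_zero_of_charTwo F, zero_add]

theorem sum_mul_self_of_commute_of_charTwo (F : Type) {B : Type} [Field F] [CharP F 2] [Ring B]
    [Algebra F B] (x : κ → B) (hx : ∀ i j, Commute (x i) (x j)) (S : Finset κ) :
    (∑ i ∈ S, x i) * ∑ i ∈ S, x i = ∑ i ∈ S, x i * x i := by
  classical
  induction S using Finset.induction with
  | empty => simp
  | insert i S hi ih =>
    have h : x i * ∑ j ∈ S, x j = (∑ j ∈ S, x j) * x i :=
      (Commute.sum_right _ _ _ fun j _ => hx i j).eq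
    rw [Finset.sum_insert hi, Finset.sum_insert hi, add_mul, mul_add, mul_add, ih, h, add_assoc,
      ← add_assoc ((∑ j ∈ S, x j) * x i), add_self_eq_zero_of_charTwo F, zero_add]

variable [DivisionRing D] [Algebra F D]

/-- If `e`, `f` is a symplectic basis adapted to a nonsingular form with nontrivial Arf invariant,
then algebra morphisms from the even Clifford algebra to a division ring are injective. -/
theorem CliffordAlgebra.even_algHom_injective [Fintype κ] (ψ : QuadraticForm F V) (e f : κ → V)
    (hee : ∀ i j, polar ψ (e i) (e j) = 0) (hff : ∀ i j, polar ψ (f i) (f j) = 0)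
    (hef : ∀ i j, i ≠ j → polar ψ (e i) (f j) = 0) (hef1 : ∀ i, polar ψ (e i) (f i) = 1)
    (hspan : Submodule.span F (Set.range e ∪ Set.range f) = ⊤) (o : κ) (ho : ψ (e o) ≠ 0)
    (hc : (∑ i, ψ (e i) * ψ (f i)) ∉ ArtinSchreier F)
    (φ : CliffordAlgebra.even ψ →ₐ[F] D) : Function.Injective φ := by
  classical
  have h2 : ∀ x : CliffordAlgebra ψ, x + x = 0 := add_self_eq_zero_of_charTwo F
  let u := CliffordAlgebra.ι ψ
  have hsw : ∀ v w, u w * u v = u v * u w + algebraMap F _ (polar ψ v w) :=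
    CliffordAlgebra.ι_mul_ι_swap_of_charTwo ψ
  have hsq : ∀ v, u v * u v = algebraMap F _ (ψ v) := CliffordAlgebra.ι_sq_scalar ψ
  have hcomm : ∀ v w, polar ψ v w = 0 → Commute (u v) (u w) := fun v w h => by
    rw [Commute, SemiconjBy, hsw v w, h, map_zero, add_zero]
  have hfe : ∀ i j, i ≠ j → polar ψ (f i) (e j) = 0 := fun i j h => by
    rw [polar_comm, hef j i h.symm]
  set a := ψ (e o) with ha
  -- the separable quadratic generator
  let Z : CliffordAlgebra ψ := ∑ i, u (e i) * u (f i)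
  have hZ : Z * Z + Z = algebraMap F _ (∑ i, ψ (e i) * ψ (f i)) := by
    have hp : ∀ i j, Commute (u (e i) * u (f i)) (u (e j) * u (f j)) := by
      intro i j
      rcases eq_or_ne i j with rfl | h
      · exact Commute.refl _
      · exact (((hcomm _ _ (hee i j)).mul_right (hcomm _ _ (hef i j h)))).mul_left
          ((hcomm _ _ (hfe i j h)).mul_right (hcomm _ _ (hff i j)))
    rw [sum_mul_self_of_commute_of_charTwo F _ hp, ← Finset.sum_add_distrib, map_sum]
    refine Finset.sum_congr rfl fun i _ => ?_
    have h1 : u (e i) * u (f i) * (u (e i) * u (f i)) =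
        u (e i) * (u (f i) * u (e i)) * u (f i) := by simp only [mul_assoc]
    rw [h1, hsw (e i) (f i), hef1, map_one, mul_add, mul_one, add_mul, ← mul_assoc, hsq, mul_assoc,
      hsq, add_assoc, h2, add_zero, map_mul]
  have hZv : ∀ v, Z * u v = u v * Z + u v := by
    intro v
    have hv : v ∈ Submodule.span F (Set.range e ∪ Set.range f) := by rw [hspan]; trivial
    have key : ∀ i v, u (e i) * u (f i) * u v = u v * (u (e i) * u (f i)) +
        (algebraMap F _ (polar ψ (f i) v) * u (e i) +
          algebraMap F _ (polar ψ (e i) v) * u (f i)) := by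
      intro i v
      have h1 := hsw v (f i)
      have h2 := hsw v (e i)
      rw [mul_assoc, h1, mul_add, ← mul_assoc, h2, add_mul, mul_assoc, polar_comm ψ v,
        polar_comm ψ v, ← Algebra.commutes (polar ψ (f i) v)]
      abel
    induction hv using Submodule.span_induction with
    | mem v hv =>
      simp only [Z, Finset.sum_mul, Finset.mul_sum, key, Finset.sum_add_distrib]
      congr 1
      rcases hv with ⟨j, rfl⟩ | ⟨j, rfl⟩
      · rw [Finset.sum_eq_single j (fun i _ h => by rw [hfe i j h, map_zero, zero_mul])
          (by simp), polar_comm, hef1, Finset.sum_eq_zero fun i _ => by rw [hee, map_zero, zero_mul]]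
        simp
      · rw [Finset.sum_eq_zero fun i _ => by rw [hff, map_zero, zero_mul],
          Finset.sum_eq_single j (fun i _ h => by rw [hef i j h, map_zero, zero_mul])
          (by simp), hef1]
        simp
    | zero => simp
    | add v w _ _ h1 h2 =>
      rw [map_add, mul_add, h1, h2, add_mul]
      abel
    | smul r v _ h => rw [map_smul, mul_smul_comm, h, smul_add, smul_mul_assoc]
  let β := (CliffordAlgebra.even.ι ψ).bilin
  have hβ : ∀ v w, (β v w : CliffordAlgebra ψ) = u v * u w := fun v w => rfl
  let z : CliffordAlgebra.even ψ := ∑ i, β (e i) (f i)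
  have hz : (z : CliffordAlgebra ψ) = Z := by
    simp only [z, Z, AddSubmonoidClass.coe_finsetSum, hβ]
  have hβz : ∀ v w, Commute (β v w) z := by
    intro v w
    refine Subtype.ext ?_
    change (β v w : CliffordAlgebra ψ) * z = z * β v w
    rw [hz, hβ, ← mul_assoc, hZv, add_mul, mul_assoc (u v) Z, hZv, mul_add, add_assoc, h2, add_zero,
      mul_assoc]
  have hββ : ∀ v w, polar ψ (e o) v = 0 → β (e o) v * β (e o) w = a • β v w := by
    intro v w h
    refine Subtype.ext ?_
    change u (e o) * u v * (u (e o) * u w) = a • (u v * u w)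
    rw [(hcomm _ _ h).eq, mul_assoc, ← mul_assoc (u (e o)), hsq, ← Algebra.smul_def, mul_smul_comm]
  have hβs : ∀ v w, β w v = β v w + algebraMap F _ (polar ψ v w) := fun v w =>
    Subtype.ext (hsw v w)
  have hβq : ∀ v, β v v = algebraMap F _ (ψ v) := (CliffordAlgebra.even.ι ψ).contract
  have hoe : ∀ i, polar ψ (e o) (e i) = 0 := hee o
  have hof : ∀ i : {i // i ≠ o}, polar ψ (e o) (f i) = 0 := fun i => hef o i i.2.symm
  have hβc : ∀ v w, polar ψ (e o) v = 0 → polar ψ (e o) w = 0 → polar ψ v w = 0 →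
      Commute (β (e o) v) (β (e o) w) := by
    intro v w hv hw hvw
    rw [Commute, SemiconjBy, hββ v w hv, hββ w v hw, hβs v w, hvw, map_zero, add_zero]
  have hne : ∀ i j : {i // i ≠ o}, i ≠ j → (i : κ) ≠ j := fun i j h => Subtype.coe_injective.ne h
  have hEG : ∀ i : {i // i ≠ o}, β (e o) (e i) * a⁻¹ • β (e o) (f i) = β (e i) (f i) := fun i => by
    rw [mul_smul_comm, hββ _ _ (hoe i), smul_smul, inv_mul_cancel₀ ho, one_smul]
  obtain ⟨T, h1, hzT, hT, -, hinj⟩ := exists_stable_submodule_injective φ (z := z)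
    (c := ∑ i, ψ (e i) * ψ (f i)) (by
      refine Subtype.ext ?_
      change (z : CliffordAlgebra ψ) * z + z = algebraMap F _ _
      rw [hz, hZ]) hc
    (fun i : {i // i ≠ o} => β (e o) (e i)) (fun i => a⁻¹ • β (e o) (f i))
    (fun i => ⟨a * ψ (e i), by
      rw [hββ _ _ (hoe i), hβq, Algebra.smul_def, map_mul]⟩)
    (fun i => ⟨a⁻¹ * (a⁻¹ * (a * ψ (f i))), by
      rw [smul_mul_assoc, mul_smul_comm, hββ _ _ (hof i), hβq, Algebra.smul_def, Algebra.smul_def,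
        Algebra.smul_def]
      simp only [map_mul]⟩)
    (fun i => by
      rw [hEG, smul_mul_assoc, hββ _ _ (hof i), smul_smul, inv_mul_cancel₀ ho, one_smul,
        hβs (e i) (f i), hef1, map_one, add_comm])
    (fun i j _ => hβc _ _ (hoe i) (hoe j) (hee _ _))
    (fun i j _ => ((hβc _ _ (hof i) (hof j) (hff _ _)).smul_left _).smul_right _)
    (fun i j h => (hβc _ _ (hoe i) (hof j) (hef _ _ (hne i j h))).smul_right _)
    (fun i => hβz _ _) (fun i => (hβz _ _).smul_left _) Finset.univ
  have hw : ∀ w, ∀ x ∈ T, β (e o) w * x ∈ T := by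
    intro w x hx
    have hw : w ∈ Submodule.span F (Set.range e ∪ Set.range f) := by rw [hspan]; trivial
    induction hw using Submodule.span_induction with
    | mem w hw =>
      rcases hw with ⟨j, rfl⟩ | ⟨j, rfl⟩
      · by_cases hj : j = o
        · rw [hj, hβq, ← Algebra.smul_def]
          exact T.smul_mem _ hx
        · exact (hT ⟨j, hj⟩ (Finset.mem_univ _) x hx).1
      · by_cases hj : j = o
        · have h3 : β (e o) (f o) = z - ∑ i : {i // i ≠ o},
              β (e o) (e i) * a⁻¹ • β (e o) (f i) := by
            rw [eq_sub_iff_add_eq]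
            simp only [hEG, z]
            exact (Fintype.sum_eq_add_sum_subtype_ne (fun i => β (e i) (f i)) o).symm
          rw [hj, h3, sub_mul]
          refine T.sub_mem (hzT x hx) ?_
          rw [Finset.sum_mul]
          refine T.sum_mem fun i _ => ?_
          rw [mul_assoc]
          have hTi := hT i (Finset.mem_univ _)
          exact (hTi _ (hTi x hx).2).1
        · have h3 := T.smul_mem a (hT ⟨j, hj⟩ (Finset.mem_univ _) x hx).2
          rwa [smul_mul_assoc, smul_smul, mul_inv_cancel₀ ho, one_smul] at h3
    | zero => simp
    | add v w _ _ h1 h2 =>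
      rw [map_add, add_mul]
      exact T.add_mem h1 h2
    | smul r v _ h =>
      rw [map_smul, smul_mul_assoc]
      exact T.smul_mem r h
  have hvw : ∀ v w, ∀ x ∈ T, β v w * x ∈ T := by
    intro v w x hx
    have h3 : β v w = a⁻¹ • (β v (e o) * β (e o) w) := by
      rw [(CliffordAlgebra.even.ι ψ).contract_mid, smul_smul, inv_mul_cancel₀ ho, one_smul]
    rw [h3, smul_mul_assoc, mul_assoc, hβs (e o) v, add_mul, ← Algebra.smul_def]
    exact T.smul_mem _ (T.add_mem (hw _ _ (hw _ _ hx)) (T.smul_mem _ (hw _ _ hx)))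
  have hall : ∀ (x : CliffordAlgebra ψ) (hx : x ∈ CliffordAlgebra.evenOdd ψ 0),
      (⟨x, hx⟩ : CliffordAlgebra.even ψ) ∈ T := by
    intro x hx
    induction x, hx using CliffordAlgebra.even_induction with
    | algebraMap r =>
      have h3 := T.smul_mem r h1
      rwa [← Algebra.algebraMap_eq_smul_one] at h3
    | add x y hx hy h3 h4 => exact T.add_mem h3 h4
    | ι_mul_ι_mul v w x hx h3 => exact hvw v w _ h3
  exact (injective_iff_map_eq_zero φ).2 fun x hx => hinj x (hall x.1 x.2) hx

end EvenInjective

section SymplecticBasis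

variable {F : Type} [Field F]

theorem binQF_apply (a b : F) (v : Fin 2 → F) :
    binQF a b v = a * v 0 ^ 2 + v 0 * v 1 + b * v 1 ^ 2 := by
  have h : binQF a b v = Matrix.toBilin' !![a, 1; 0, b] v v := rfl
  rw [h, Matrix.toBilin'_apply]
  simp [Fin.sum_univ_two]
  ring

theorem binsQF_apply {r : ℕ} (a b : Fin r → F) (v : Fin r → Fin 2 → F) :
    binsQF a b v = ∑ i, (a i * v i 0 ^ 2 + v i 0 * v i 1 + b i * v i 1 ^ 2) := by
  simp [binsQF, QuadraticMap.pi_apply, binQF_apply]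

theorem polar_binsQF [CharP F 2] {r : ℕ} (a b : Fin r → F) (v w : Fin r → Fin 2 → F) :
    polar (binsQF a b) v w = ∑ i, (v i 0 * w i 1 + v i 1 * w i 0) := by
  simp only [polar, binsQF_apply, ← Finset.sum_sub_distrib]
  refine Finset.sum_congr rfl fun i _ => ?_
  simp only [Pi.add_apply]
  linear_combination (a i * v i 0 * w i 0 + b i * v i 1 * w i 1) * CharTwo.two_eq_zero (R := F)

theorem exists_symplectic_basis [CharP F 2] {V : Type} [AddCommGroup V] [Module F V]
    {ψ : QuadraticForm F V} {r : ℕ} {a b : Fin r → F} (h : ψ.Equivalent (binsQF a b)) :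
    ∃ e f : Fin r → V, (∀ i j, polar ψ (e i) (e j) = 0) ∧ (∀ i j, polar ψ (f i) (f j) = 0) ∧
      (∀ i j, i ≠ j → polar ψ (e i) (f j) = 0) ∧ (∀ i, polar ψ (e i) (f i) = 1) ∧
      Submodule.span F (Set.range e ∪ Set.range f) = ⊤ ∧ (∀ i, ψ (e i) = a i) ∧
      ∀ i, ψ (f i) = b i := by
  obtain ⟨g⟩ := h
  have hg : ∀ v, ψ (g.symm v) = binsQF a b v := g.symm.map_app
  have hp : ∀ v w, polar ψ (g.symm v) (g.symm w) = polar (binsQF a b) v w := fun v w => by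
    have hadd : g.symm v + g.symm w = g.symm (v + w) := (map_add g.symm.toLinearEquiv v w).symm
    rw [polar, polar, hadd, hg, hg, hg]
  refine ⟨fun i => g.symm (Pi.single i (Pi.single 0 1)), fun i => g.symm (Pi.single i (Pi.single 1 1)),
    fun i j => ?_, fun i j => ?_, fun i j h => ?_, fun i => ?_, ?_, fun i => ?_, fun i => ?_⟩
  · rw [hp, polar_binsQF]
    refine Finset.sum_eq_zero fun k _ => ?_
    rcases eq_or_ne k i with rfl | hi <;> rcases eq_or_ne k j with rfl | hj <;> simp [*]
  · rw [hp, polar_binsQF]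
    refine Finset.sum_eq_zero fun k _ => ?_
    rcases eq_or_ne k i with rfl | hi <;> rcases eq_or_ne k j with rfl | hj <;> simp [*]
  · rw [hp, polar_binsQF]
    refine Finset.sum_eq_zero fun k _ => ?_
    rcases eq_or_ne k i with rfl | hi <;> simp [*]
  · rw [hp, polar_binsQF, Finset.sum_eq_single i] <;> simp +contextual
  · rw [eq_top_iff]
    intro v _
    have hv : v = g.symm (∑ i : Fin r, (g v i 0 • (Pi.single i (Pi.single 0 1) : Fin r → Fin 2 → F) +
        g v i 1 • (Pi.single i (Pi.single 1 1) : Fin r → Fin 2 → F))) := by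
      have h1 : ∑ i : Fin r, (g v i 0 • (Pi.single i (Pi.single 0 1) : Fin r → Fin 2 → F) +
        g v i 1 • (Pi.single i (Pi.single 1 1) : Fin r → Fin 2 → F)) = g v := by
        funext i k
        rw [Finset.sum_apply, Finset.sum_apply, Finset.sum_eq_single i]
        · fin_cases k <;> simp
        · intro j _ hj
          simp [hj.symm]
        · simp
      rw [h1]
      exact (g.toLinearEquiv.symm_apply_apply v).symm
    rw [hv]
    have h2 : ∀ w, g.symm w = g.symm.toLinearEquiv w := fun _ => rfl
    rw [h2, map_sum]
    refine Submodule.sum_mem _ fun i _ => ?_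
    rw [map_add, map_smul, map_smul]
    exact Submodule.add_mem _ (Submodule.smul_mem _ _ (Submodule.subset_span (Or.inl ⟨i, rfl⟩)))
      (Submodule.smul_mem _ _ (Submodule.subset_span (Or.inr ⟨i, rfl⟩)))
  · rw [hg, binsQF_apply, Finset.sum_eq_single i] <;> simp +contextual
  · rw [hg, binsQF_apply, Finset.sum_eq_single i] <;> simp +contextual

theorem CliffordAlgebra.even_algHom_injective_of_equivalent [CharP F 2] {V D : Type}
    [AddCommGroup V] [Module F V] [DivisionRing D] [Algebra F D] {ψ : QuadraticForm F V} {r : ℕ}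
    {a b : Fin r → F} (h : ψ.Equivalent (binsQF a b)) (hc : (∑ i, a i * b i) ∉ ArtinSchreier F)
    (φ : CliffordAlgebra.even ψ →ₐ[F] D) : Function.Injective φ := by
  obtain ⟨e, f, hee, hff, hef, hef1, hspan, he, hf⟩ := exists_symplectic_basis h
  obtain ⟨o, ho⟩ : ∃ o, a o * b o ≠ 0 := by
    by_contra! h0
    exact hc ⟨0, by simp [h0]⟩
  refine CliffordAlgebra.even_algHom_injective ψ e f hee hff hef hef1 hspan o ?_ ?_ φ
  · rw [he]
    exact left_ne_zero_of_mul ho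
  · simpa only [he, hf] using hc

theorem exists_anisotropic_of_equivalent [CharP F 2] {V : Type} [AddCommGroup V] [Module F V]
    {ψ : QuadraticForm F V} {r : ℕ} {a b : Fin r → F} (h : ψ.Equivalent (binsQF a b))
    (hc : (∑ i, a i * b i) ∉ ArtinSchreier F) : ∃ v, ψ v ≠ 0 := by
  obtain ⟨e, f, -, -, -, -, -, he, -⟩ := exists_symplectic_basis h
  by_contra! h0
  exact hc ⟨0, by simp [← he, h0]⟩

end SymplecticBasis

section RepToHom

variable {F V D : Type} [Field F] [AddCommGroup V] [Module F V]

theorem QuadraticMap.eq_zero_of_basis {N ι : Type} [AddCommGroup N] [Module F N] [LinearOrder ι]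
    (q : QuadraticMap F V N) (b : Module.Basis ι F V) (h : ∀ i, q (b i) = 0)
    (h' : ∀ i j, i ≠ j → polar q (b i) (b j) = 0) : q = 0 := by
  have h0 : q.toBilin b = 0 := by
    refine b.ext fun i => b.ext fun j => ?_
    rw [toBilin_apply]
    split_ifs with h1 h2
    · simp [h]
    · simp [h' i j h1]
    · simp
  rw [← toQuadraticMap_toBilin q b, h0]
  simp

variable [DivisionRing D] [Algebra F D]

/-- A linear map `f` with `f(v)² + λ(v) f(v) = ψ(v) / a` yields a morphism from the even Clifford
algebra of `ψ`. -/
theorem CliffordAlgebra.exists_even_algHom (ψ : QuadraticForm F V) {a : F} (ha : a ≠ 0)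
    (f : V →ₗ[F] D) (lam : V →ₗ[F] F)
    (h : ∀ v, f v * f v + lam v • f v = (a⁻¹ * ψ v) • 1) :
    Nonempty (CliffordAlgebra.even ψ →ₐ[F] D) := by
  let f' : V →ₗ[F] D := f + (Algebra.linearMap F D).comp lam
  have hf' : ∀ v, f' v = f v + lam v • 1 := fun v => by
    simp [f', Algebra.algebraMap_eq_smul_one]
  let β : V →ₗ[F] V →ₗ[F] D := a • (LinearMap.mul F D).compl₁₂ f f'
  have hβ : ∀ v w, β v w = a • (f v * f' w) := fun v w => rfl
  have h1 : ∀ v, f v * f' v = (a⁻¹ * ψ v) • 1 := fun v => by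
    rw [hf', mul_add, mul_smul_comm, mul_one, h]
  have h2 : ∀ v, f' v * f v = (a⁻¹ * ψ v) • 1 := fun v => by
    rw [hf', add_mul, smul_mul_assoc, one_mul, h]
  refine ⟨CliffordAlgebra.even.lift ψ ⟨β, fun v => ?_, fun u v w => ?_⟩⟩
  · rw [hβ, h1, smul_smul, mul_inv_cancel_left₀ ha, Algebra.algebraMap_eq_smul_one]
  · have h3 : f u * f' v * (f v * f' w) = f u * (f' v * f v) * f' w := by simp only [mul_assoc]
    rw [hβ, hβ, hβ, smul_mul_smul_comm, h3, h2, mul_smul_comm, mul_one, smul_mul_assoc, smul_smul,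
      smul_smul]
    congr 1
    field_simp

theorem CliffordAlgebra.exists_even_algHom_of_rep [CharP F 2] {m : ℕ} (ψ : QuadraticForm F V)
    (b : Module.Basis (Fin (m + 1)) F V) (B : LinearMap.BilinForm F V) (hB : ∀ v, B v v = ψ v)
    (h0 : ψ (b 0) ≠ 0) (x : Fin m → D)
    (hx : IsCliffordRep (fun i => algebraMap F D ((ψ (b 0))⁻¹ * polar ψ (b i.succ) (b 0)))
      (fun i k => algebraMap F D ((ψ (b 0))⁻¹ * B (b i.succ) (b k.succ))) x) :
    Nonempty (CliffordAlgebra.even ψ →ₐ[F] D) := by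
  have h2 : ∀ x : D, x + x = 0 := add_self_eq_zero_of_charTwo F
  have hneg : ∀ x y : D, x + y = 0 → x = y := fun x y h => by
    rw [← add_zero x, ← h2 y, ← add_assoc, h, zero_add]
  have hp : ∀ v w, polar ψ v w = B v w + B w v := fun v w => by
    simp only [polar, ← hB, map_add, LinearMap.add_apply]
    ring
  set a := ψ (b 0) with ha
  let f : V →ₗ[F] D := b.constr F (Fin.cons 1 x : Fin (m + 1) → D)
  have f0 : f (b 0) = 1 := b.constr_basis F _ 0
  have f1 : ∀ i, f (b (Fin.succ i)) = x i := fun i => b.constr_basis F _ _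
  let lam : V →ₗ[F] F := a⁻¹ • ψ.polarBilin.flip (b 0)
  have hlam : ∀ v, lam v = a⁻¹ * polar ψ v (b 0) := fun v => rfl
  let P : V →ₗ[F] V →ₗ[F] D := (LinearMap.mul F D).compl₁₂ f f +
    (LinearMap.lsmul F D).compl₁₂ lam f + (a⁻¹ • B).compr₂ (Algebra.linearMap F D)
  have hP : ∀ v w, P v w = f v * f w + lam v • f w + (a⁻¹ * B v w) • 1 := fun v w => by
    simp [P, Algebra.algebraMap_eq_smul_one]
  have hl0 : lam (b 0) = 0 := by
    rw [hlam, polar_self, two_smul, CharTwo.add_self_eq_zero, mul_zero]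
  have hB0 : a⁻¹ * B (b 0) (b 0) = 1 := by rw [hB, ← ha, inv_mul_cancel₀ h0]
  simp only [Algebra.algebraMap_eq_smul_one, IsCliffordRep, ← hlam, smul_mul_assoc, one_mul] at hx
  have hP0 : LinearMap.BilinMap.toQuadraticMap P = 0 := by
    have h01 : ∀ i : Fin m, P (b 0) (b i.succ) + P (b i.succ) (b 0) = 0 := by
      intro i
      rw [hP, hP, f0, f1, hl0, zero_smul, one_mul, mul_one, add_zero]
      have h3 : lam (b i.succ) = a⁻¹ * B (b 0) (b i.succ) + a⁻¹ * B (b i.succ) (b 0) := by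
        rw [hlam, hp]
        ring
      rw [h3, add_smul]
      set p := (a⁻¹ * B (b 0) (b i.succ)) • (1 : D)
      set q := (a⁻¹ * B (b i.succ) (b 0)) • (1 : D)
      have h4 : x i + p + (x i + (p + q) + q) = x i + x i + (p + p) + (q + q) := by abel
      rw [h4, h2 (x i), h2 p, h2 q, add_zero, add_zero]
    refine QuadraticMap.eq_zero_of_basis _ b (fun i => ?_) fun i j hij => ?_
    · rw [LinearMap.BilinMap.toQuadraticMap_apply, hP]
      refine Fin.cases ?_ (fun i => ?_) i
      · rw [f0, hl0, hB0, zero_smul, add_zero, mul_one, one_smul, h2]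
      · rw [f1]
        exact hx.1 i
    · rw [LinearMap.BilinMap.polar_toQuadraticMap]
      revert hij
      refine Fin.cases ?_ (fun i => ?_) i <;> refine Fin.cases ?_ (fun j => ?_) j <;> intro hij
      · exact absurd rfl hij
      · exact h01 j
      · rw [add_comm]
        exact h01 i
      · rw [hP, hP, f1, f1, ← hx.2 i j (by simpa using hij)]
        abel
  refine CliffordAlgebra.exists_even_algHom ψ h0 f lam fun v => hneg _ _ ?_
  have h3 := DFunLike.congr_fun hP0 v
  rwa [LinearMap.BilinMap.toQuadraticMap_apply, hP, hB] at h3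

end RepToHom

section FunctionField

variable {F : Type} [Field F] {n : ℕ}

instance (ψ : QuadraticForm F (Fin n → F)) :
    IsScalarTower F (FunFieldRing F ψ) (FunField F ψ) :=
  inferInstanceAs (IsScalarTower F (FunFieldRing F ψ) (FractionRing (FunFieldRing F ψ)))

instance (ψ : QuadraticForm F (Fin n → F)) : IsFractionRing (FunFieldRing F ψ) (FunField F ψ) :=
  inferInstanceAs (IsFractionRing (FunFieldRing F ψ) (FractionRing (FunFieldRing F ψ)))

/-- The quotient map onto the coordinate ring of the affine quadric. -/
noncomputable def funFieldRingMk (ψ : QuadraticForm F (Fin n → F)) :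
    MvPolynomial (Fin n) F →ₐ[F] FunFieldRing F ψ :=
  Ideal.Quotient.mkₐ F (Ideal.span {qfPoly F ψ})

theorem funFieldRingMk_surjective (ψ : QuadraticForm F (Fin n → F)) :
    Function.Surjective (funFieldRingMk ψ) :=
  Ideal.Quotient.mkₐ_surjective _ _

theorem funFieldRingMk_eq_zero_iff (ψ : QuadraticForm F (Fin n → F))
    (p : MvPolynomial (Fin n) F) : funFieldRingMk ψ p = 0 ↔ qfPoly F ψ ∣ p :=
  Ideal.Quotient.eq_zero_iff_mem.trans Ideal.mem_span_singleton

theorem isHomogeneous_qfPoly (ψ : QuadraticForm F (Fin n → F)) : (qfPoly F ψ).IsHomogeneous 2 := by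
  refine IsHomogeneous.sum _ _ _ fun i _ => IsHomogeneous.sum _ _ _ fun j _ => ?_
  simpa using (isHomogeneous_C (Fin n) (coeffMat F ψ i j)).mul
    ((isHomogeneous_X F i).mul (isHomogeneous_X F j))

/-- The coordinate functions on the quadric `ψ = 0`. -/
noncomputable def funFieldCoord (ψ : QuadraticForm F (Fin n → F)) (i : Fin n) : FunField F ψ :=
  algebraMap (FunFieldRing F ψ) (FunField F ψ) (funFieldRingMk ψ (X i))

theorem sum_coeffMat_funFieldCoord (ψ : QuadraticForm F (Fin n → F)) :
    ∑ i, ∑ j, coeffMat F ψ i j • (funFieldCoord ψ i * funFieldCoord ψ j) = 0 := by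
  have h := (funFieldRingMk_eq_zero_iff ψ (qfPoly F ψ)).2 dvd_rfl
  have h1 := congrArg (IsScalarTower.toAlgHom F (FunFieldRing F ψ) (FunField F ψ)) h
  rw [map_zero] at h1
  rw [← h1, qfPoly]
  simp only [map_sum, map_mul, funFieldCoord, ← algebraMap_eq, AlgHom.commutes, Algebra.smul_def]
  rfl

theorem linearIndependent_funFieldCoord (ψ : QuadraticForm F (Fin n → F)) :
    LinearIndependent F (funFieldCoord ψ) := by
  refine Fintype.linearIndependent_iff.2 fun c hc i => ?_
  have h1 : algebraMap (FunFieldRing F ψ) (FunField F ψ)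
      (funFieldRingMk ψ (∑ i, c i • X i)) = 0 := by
    rw [← hc, map_sum, map_sum]
    refine Finset.sum_congr rfl fun i _ => ?_
    rw [map_smul, funFieldCoord]
    exact map_smul (IsScalarTower.toAlgHom F (FunFieldRing F ψ) (FunField F ψ)) _ _
  rw [map_eq_zero_iff _ (IsFractionRing.injective _ _), funFieldRingMk_eq_zero_iff] at h1
  obtain ⟨p, hp⟩ := h1
  have h2 := congrArg (coeff (Finsupp.single i 1)) hp
  have h3 : coeff (Finsupp.single i 1) (qfPoly F ψ * p) = 0 := by
    rw [coeff_mul]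
    refine Finset.sum_eq_zero fun d hd => ?_
    rw [(isHomogeneous_qfPoly ψ).coeff_eq_zero, zero_mul]
    intro h3
    have h4 := congrArg Finsupp.degree (Finset.HasAntidiagonal.mem_antidiagonal.1 hd)
    rw [map_add, h3, Finsupp.degree_single] at h4
    omega
  rw [h3] at h2
  simpa [coeff_sum, coeff_X, Finsupp.single_left_inj] using h2

theorem Finset.sum_sum_eq_zero_of_alternating {ι M : Type} [Fintype ι] [AddCommMonoid M]
    (g : ι → ι → M) (h : ∀ i, g i i = 0) (h' : ∀ i j, g i j + g j i = 0) :
    ∑ i, ∑ j, g i j = 0 := by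
  classical
  rw [← Fintype.sum_prod_type']
  refine Finset.sum_involution (fun p _ => p.swap) (fun p _ => h' p.1 p.2) (fun p _ hp hs => hp ?_)
    (fun _ _ => Finset.mem_univ _) (fun p _ => p.swap_swap)
  rw [show p.1 = p.2 from congrArg Prod.snd hs]
  exact h _

theorem TensorProduct.sum_tmul_ne_zero {D L ι : Type} [Fintype ι] [AddCommGroup D] [Module F D]
    [AddCommGroup L] [Module F L] {x : ι → L} (hx : LinearIndependent F x) {d : ι → D} {k : ι}
    (hk : d k ≠ 0) : ∑ i, d i ⊗ₜ[F] x i ≠ 0 := by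
  obtain ⟨g, hg⟩ := (Finsupp.linearCombination F x).exists_leftInverse_of_injective
    (LinearMap.ker_eq_bot.2 hx)
  have hg' : ∀ i, g (x i) = Finsupp.single i 1 := fun i => by
    simpa using LinearMap.congr_fun hg (Finsupp.single i 1)
  intro h
  have h1 := congrArg ((TensorProduct.rid F D).toLinearMap.comp
    (LinearMap.lTensor D ((Finsupp.lapply k).comp g))) h
  classical
  rw [map_sum, map_zero, Finset.sum_eq_single k] at h1
  · simp [hg'] at h1
    exact hk h1
  · intro i _ hi
    simp [hg', hi]
  · simp

/-- If the even Clifford algebra of `ψ` maps to `D`, then `D` is not a division algebra over the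
function field of `ψ`. -/
theorem not_isDivisionAlgebra_of_even_algHom {D : Type} [DivisionRing D] [Algebra F D]
    (ψ : QuadraticForm F (Fin n → F)) {v₀ : Fin n → F} (h₀ : ψ v₀ ≠ 0)
    (φ : CliffordAlgebra.even ψ →ₐ[F] D) : ¬ IsDivisionAlgebra (D ⊗[F] FunField F ψ) := by
  rintro ⟨-, hdiv⟩
  let β : (Fin n → F) →ₗ[F] (Fin n → F) →ₗ[F] D :=
    ((CliffordAlgebra.even.ι ψ).compr₂ φ).bilin
  have hself : ∀ v, β v v = algebraMap F D (ψ v) := ((CliffordAlgebra.even.ι ψ).compr₂ φ).contract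
  have hmul : ∀ u v w, β u v * β v w = ψ v • β u w :=
    ((CliffordAlgebra.even.ι ψ).compr₂ φ).contract_mid
  have hswap : ∀ v w, β v w + β w v = algebraMap F D (polar ψ v w) := fun v w => by
    rw [polar, map_sub, map_sub, ← hself, ← hself, ← hself, map_add, map_add, LinearMap.add_apply,
      LinearMap.add_apply]
    abel
  have h₀' : β v₀ v₀ ≠ 0 := by
    rw [hself]
    simpa using h₀
  have hexists : ∀ g : (Fin n → F) →ₗ[F] D, g v₀ ≠ 0 → ∃ i, g (Pi.single i 1) ≠ 0 := by
    intro g hg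
    by_contra! h
    have h1 : g = 0 := (Pi.basisFun F (Fin n)).ext fun i => by simpa using h i
    exact hg (by rw [h1, LinearMap.zero_apply])
  obtain ⟨i, hi⟩ := hexists (β.flip v₀) h₀'
  obtain ⟨k, hk⟩ := hexists (β v₀) h₀'
  have hx := linearIndependent_funFieldCoord ψ
  have hX : ∑ i, β (Pi.single i 1) v₀ ⊗ₜ[F] funFieldCoord ψ i ≠ 0 :=
    TensorProduct.sum_tmul_ne_zero hx hi
  have hY : ∑ i, β v₀ (Pi.single i 1) ⊗ₜ[F] funFieldCoord ψ i ≠ 0 :=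
    TensorProduct.sum_tmul_ne_zero hx hk
  refine hY ((hdiv _ hX).mul_right_eq_zero.1 ?_)
  have halt := Finset.sum_sum_eq_zero_of_alternating
    (fun i j => (β (Pi.single i 1) (Pi.single j 1) - algebraMap F D (coeffMat F ψ i j)) ⊗ₜ[F]
      (funFieldCoord ψ i * funFieldCoord ψ j)) (fun i => by simp [hself, coeffMat]) (fun i j => by
      rw [mul_comm (funFieldCoord ψ j), ← TensorProduct.add_tmul, sub_add_sub_comm, hswap,
        ← map_add]
      rcases lt_trichotomy i j with h | rfl | h
      · simp [coeffMat, h, h.ne, h.ne', h.not_gt]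
      · simp [coeffMat, polar_self, two_mul]
      · simp [coeffMat, h, h.ne, h.ne', h.not_gt, polar_comm ψ (Pi.single i 1)])
  have hcoeff : ∑ i, ∑ j, algebraMap F D (coeffMat F ψ i j) ⊗ₜ[F]
      (funFieldCoord ψ i * funFieldCoord ψ j) = 0 := by
    rw [← TensorProduct.tmul_zero (FunField F ψ) (1 : D), ← sum_coeffMat_funFieldCoord ψ]
    simp only [TensorProduct.tmul_sum, Algebra.algebraMap_eq_smul_one, TensorProduct.smul_tmul]
  have hall : ∑ i, ∑ j, β (Pi.single i 1) (Pi.single j 1) ⊗ₜ[F]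
      (funFieldCoord ψ i * funFieldCoord ψ j) = 0 := by
    simpa only [TensorProduct.sub_tmul, Finset.sum_sub_distrib, hcoeff, sub_zero] using halt
  rw [Finset.sum_mul_sum]
  simp only [Algebra.TensorProduct.tmul_mul_tmul, hmul, ← TensorProduct.smul_tmul',
    ← Finset.smul_sum, hall, smul_zero]

end FunctionField

section FractionField

variable {F D R L : Type} [Field F] [DivisionRing D] [Algebra F D] [CommRing R] [Algebra F R]
  [CommRing L] [Algebra F L] [Algebra R L] [IsScalarTower F R L]

theorem exists_one_tmul_mul_eq_map [IsDomain R] [IsFractionRing R L] (w : D ⊗[F] L) :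
    ∃ s : R, s ≠ 0 ∧ ∃ u : D ⊗[F] R, (1 ⊗ₜ algebraMap R L s) * w =
      Algebra.TensorProduct.map (AlgHom.id F D) (IsScalarTower.toAlgHom F R L) u := by
  induction w with
  | zero => exact ⟨1, one_ne_zero, 0, by simp⟩
  | tmul d z =>
    obtain ⟨⟨p, s⟩, h⟩ := IsLocalization.surj (nonZeroDivisors R) z
    refine ⟨s, nonZeroDivisors.coe_ne_zero s, d ⊗ₜ p, ?_⟩
    simpa [mul_comm] using congrArg (d ⊗ₜ[F] ·) h
  | add w w' h h' =>
    obtain ⟨s, hs, u, hu⟩ := h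
    obtain ⟨s', hs', u', hu'⟩ := h'
    refine ⟨s * s', mul_ne_zero hs hs', (1 ⊗ₜ s') * u + (1 ⊗ₜ s) * u', ?_⟩
    rw [map_add, map_mul _ _ u, map_mul _ _ u', ← hu, ← hu', mul_add, ← mul_assoc, ← mul_assoc]
    simp [mul_comm]

/-- If `D ⊗ R` is a domain then `D` remains a division algebra over the fraction field of `R`. -/
theorem isDivisionAlgebra_tensorProduct_of_noZeroDivisors [FiniteDimensional F D] [IsDomain R]
    [IsFractionRing R L]
    (h : ∀ u v : D ⊗[F] R, u * v = 0 → u = 0 ∨ v = 0) : IsDivisionAlgebra (D ⊗[F] L) := by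
  let : Field L := IsFractionRing.toField R
  have hmap : Function.Injective
      (Algebra.TensorProduct.map (AlgHom.id F D) (IsScalarTower.toAlgHom F R L)) :=
    Module.Flat.lTensor_preserves_injective_linearMap (M := D)
      (IsScalarTower.toAlgHom F R L).toLinearMap (IsFractionRing.injective R L)
  have hcancel : ∀ (s : R) (w : D ⊗[F] L), s ≠ 0 → (1 ⊗ₜ algebraMap R L s) * w = 0 → w = 0 := by
    intro s w hs hw
    have hs' : algebraMap R L s ≠ 0 := by
      simpa using (IsFractionRing.injective R L).ne hs
    have h1 : (1 ⊗ₜ (algebraMap R L s)⁻¹ : D ⊗[F] L) * ((1 ⊗ₜ algebraMap R L s) * w) = w := by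
      rw [← mul_assoc, Algebra.TensorProduct.tmul_mul_tmul, inv_mul_cancel₀ hs', one_mul,
        ← Algebra.TensorProduct.one_def, one_mul]
    rw [← h1, hw, mul_zero]
  have hcentral : ∀ (z : L) (w : D ⊗[F] L), Commute (1 ⊗ₜ z) w := fun z w => by
    induction w with
    | zero => exact Commute.zero_right _
    | tmul d z' => simp [Commute, SemiconjBy, mul_comm]
    | add w w' h h' => exact h.add_right h'
  have : NoZeroDivisors (D ⊗[F] L) := by
    refine ⟨fun {w w'} hw => ?_⟩
    obtain ⟨s, hs, u, hu⟩ := exists_one_tmul_mul_eq_map (R := R) w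
    obtain ⟨s', hs', u', hu'⟩ := exists_one_tmul_mul_eq_map (R := R) w'
    have h1 : u * u' = 0 := by
      refine hmap ?_
      rw [map_mul, ← hu, ← hu', mul_assoc, ← mul_assoc w, ← (hcentral _ w).eq, mul_assoc _ w, hw,
        mul_zero, mul_zero, map_zero]
    refine (h u u' h1).imp (fun h0 => hcancel s w hs ?_) fun h0 => hcancel s' w' hs' ?_
    · rw [hu, h0, map_zero]
    · rw [hu', h0, map_zero]
  have e := Algebra.TensorProduct.comm F D L
  have : NoZeroDivisors (L ⊗[F] D) :=
    e.symm.injective.noZeroDivisors e.symm (map_zero _) (map_mul _)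
  have : IsDomain (L ⊗[F] D) := NoZeroDivisors.to_isDomain _
  refine ⟨zero_ne_one, fun w hw => ?_⟩
  simpa using (FiniteDimensional.isUnit L (e.map_ne_zero_iff.2 hw)).map e.symm

end FractionField

section QuadraticExtension

variable {Z K : Type} [CommRing Z] [DivisionRing K] [Algebra Z K]

theorem QuadraticAlgebra.tmul_one_add_tmul_omega_eq_zero {a b : Z} {r s : K}
    (h : (r ⊗ₜ 1 + s ⊗ₜ omega : K ⊗[Z] QuadraticAlgebra Z a b) = 0) : r = 0 ∧ s = 0 := by
  have h1 := congrArg (Algebra.TensorProduct.basis K (QuadraticAlgebra.basis a b)).repr h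
  simp only [map_add, Algebra.TensorProduct.basis_repr_tmul, map_zero] at h1
  have h2 := fun i => DFunLike.congr_fun h1 i
  constructor
  · simpa using h2 0
  · simpa using h2 1

theorem QuadraticAlgebra.exists_eq_tmul_one_add_tmul_omega {a b : Z}
    (w : K ⊗[Z] QuadraticAlgebra Z a b) : ∃ r s : K, w = r ⊗ₜ 1 + s ⊗ₜ omega := by
  induction w with
  | zero => exact ⟨0, 0, by simp⟩
  | tmul k z =>
    refine ⟨z.re • k, z.im • k, ?_⟩
    rw [TensorProduct.smul_tmul, TensorProduct.smul_tmul, ← TensorProduct.tmul_add]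
    congr 1
    ext <;> simp
  | add w w' h h' =>
    obtain ⟨r, s, rfl⟩ := h
    obtain ⟨r', s', rfl⟩ := h'
    exact ⟨r + r', s + s', by rw [TensorProduct.add_tmul, TensorProduct.add_tmul]; abel⟩

/-- Adjoining to `K` a root of a central quadratic polynomial without roots in `K` gives a
domain. -/
theorem QuadraticAlgebra.eq_zero_or_eq_zero_of_mul_eq_zero {l q : Z}
    (h : ∀ θ : K, θ * θ + algebraMap Z K l * θ + algebraMap Z K q ≠ 0)
    (u v : K ⊗[Z] QuadraticAlgebra Z (-q) (-l)) (huv : u * v = 0) : u = 0 ∨ v = 0 := by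
  obtain ⟨r₀, r₁, rfl⟩ := exists_eq_tmul_one_add_tmul_omega u
  obtain ⟨s₀, s₁, rfl⟩ := exists_eq_tmul_one_add_tmul_omega v
  have hq : ∀ k : K, k * algebraMap Z K q = algebraMap Z K q * k := fun k =>
    (Algebra.commutes q k).symm
  have hl : ∀ k : K, k * algebraMap Z K l = algebraMap Z K l * k := fun k =>
    (Algebra.commutes l k).symm
  set q' := algebraMap Z K q with hq'
  set l' := algebraMap Z K l with hl'
  have hmul : ((r₀ * s₀ - q' * (r₁ * s₁)) ⊗ₜ 1 + (r₀ * s₁ + r₁ * s₀ - l' * (r₁ * s₁)) ⊗ₜ omega :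
      K ⊗[Z] QuadraticAlgebra Z (-q) (-l)) = 0 := by
    rw [← huv, hq', hl', ← Algebra.smul_def, ← Algebra.smul_def, TensorProduct.sub_tmul,
      TensorProduct.sub_tmul, TensorProduct.smul_tmul, TensorProduct.smul_tmul, add_mul, mul_add,
      mul_add]
    simp only [Algebra.TensorProduct.tmul_mul_tmul, one_mul, mul_one, omega_mul_omega_eq_add,
      TensorProduct.tmul_add, TensorProduct.add_tmul, neg_smul, TensorProduct.tmul_neg]
    abel
  obtain ⟨h0, h1⟩ := tmul_one_add_tmul_omega_eq_zero hmul
  rw [sub_eq_zero] at h0 h1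
  by_cases hs : s₁ = 0
  · subst hs
    simp only [mul_zero, zero_add, mul_eq_zero] at h0 h1
    by_cases hs0 : s₀ = 0
    · simp [hs0]
    · simp [h0.resolve_right hs0, h1.resolve_right hs0]
  · obtain ⟨s, rfl⟩ : ∃ s, s₀ = s * s₁ := ⟨s₀ * s₁⁻¹, by rw [inv_mul_cancel_right₀ hs]⟩
    have h2 : r₀ * s = q' * r₁ := mul_right_cancel₀ hs (by rw [mul_assoc, h0, mul_assoc])
    have h3 : r₀ + r₁ * s = l' * r₁ :=
      mul_right_cancel₀ hs (by rw [add_mul, mul_assoc r₁, h1, mul_assoc])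
    have h4 : r₁ * ((-s) * (-s) + l' * (-s) + q') = 0 := by
      have h5 : r₀ = l' * r₁ - r₁ * s := eq_sub_of_add_eq h3
      rw [h5, sub_mul, ← hl, mul_assoc, mul_assoc, ← hq] at h2
      rw [mul_add, mul_add, ← h2]
      noncomm_ring
    have h5 : r₁ = 0 := (mul_eq_zero.1 h4).resolve_right (h _)
    rw [h5] at h3
    left
    simp_all

end QuadraticExtension

section ChangeOfCoordinates

variable {F : Type} [Field F] {n m : ℕ}

theorem exists_bilinForm_of_quadraticForm (ψ : QuadraticForm F (Fin n → F)) :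
    ∃ B : LinearMap.BilinForm F (Fin n → F), (∀ v, B v v = ψ v) ∧
      ∀ v w, B v w = ∑ i, ∑ j, v i * w j * coeffMat F ψ i j := by
  have h : Matrix.toBilin' (coeffMat F ψ) = ψ.toBilin (Pi.basisFun F (Fin n)) := by
    refine LinearMap.BilinForm.ext_basis (Pi.basisFun F (Fin n)) fun i j => ?_
    rw [toBilin_apply, Pi.basisFun_apply, Pi.basisFun_apply, Matrix.toBilin'_single]
    rfl
  refine ⟨Matrix.toBilin' (coeffMat F ψ), fun v => ?_, fun v w => ?_⟩
  · rw [h, ← LinearMap.BilinMap.toQuadraticMap_apply, toQuadraticMap_toBilin]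
  · rw [Matrix.toBilin'_apply]
    exact Finset.sum_congr rfl fun i _ => Finset.sum_congr rfl fun j _ => mul_right_comm _ _ _

theorem polar_eq_add_of_self {V : Type} [AddCommGroup V] [Module F V] {ψ : QuadraticForm F V}
    {B : LinearMap.BilinForm F V} (hB : ∀ v, B v v = ψ v) (v w : V) :
    polar ψ v w = B v w + B w v := by
  rw [polar, ← hB, ← hB, ← hB, map_add, map_add, LinearMap.add_apply, LinearMap.add_apply]
  ring

theorem Finset.sum_sum_comm_sum_sum {ι κ M : Type} [Fintype ι] [Fintype κ] [AddCommMonoid M]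
    (f : ι → ι → κ → κ → M) :
    ∑ i, ∑ j, ∑ k, ∑ l, f i j k l = ∑ k, ∑ l, ∑ i, ∑ j, f i j k l := by
  calc ∑ i, ∑ j, ∑ k, ∑ l, f i j k l = ∑ i, ∑ k, ∑ l, ∑ j, f i j k l :=
        Finset.sum_congr rfl fun i _ => Finset.sum_comm.trans
          (Finset.sum_congr rfl fun k _ => Finset.sum_comm)
    _ = ∑ k, ∑ l, ∑ i, ∑ j, f i j k l := Finset.sum_comm.trans
          (Finset.sum_congr rfl fun k _ => Finset.sum_comm)

/-- The quadric equation in the coordinates attached to the basis `b`, normalised by the value of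
the form on the first basis vector. -/
theorem aeval_qfPoly_eq {S : Type} [CommRing S] [Algebra F S] {ψ : QuadraticForm F (Fin n → F)}
    {B : LinearMap.BilinForm F (Fin n → F)} (hB : ∀ v, B v v = ψ v)
    (hB' : ∀ v w, B v w = ∑ i, ∑ j, v i * w j * coeffMat F ψ i j)
    (b : Fin (m + 1) → Fin n → F) (h0 : ψ (b 0) ≠ 0) (y : S) (x : Fin m → S) :
    aeval (fun j => ∑ k, b k j • Fin.cons (α := fun _ => S) y x k) (qfPoly F ψ) =
      ψ (b 0) • (y * y + (∑ i, ((ψ (b 0))⁻¹ * polar ψ (b i.succ) (b 0)) • x i) * y +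
        ∑ i, ∑ k, ((ψ (b 0))⁻¹ * B (b i.succ) (b k.succ)) • (x i * x k)) := by
  have h1 : aeval (fun j => ∑ k, b k j • Fin.cons (α := fun _ => S) y x k) (qfPoly F ψ) =
      ∑ k, ∑ l, B (b k) (b l) • (Fin.cons (α := fun _ => S) y x k *
        Fin.cons (α := fun _ => S) y x l) := by
    simp only [qfPoly, map_sum, map_mul, aeval_X, algHom_C, hB', Finset.sum_smul,
      Finset.sum_mul_sum]
    simp only [Finset.mul_sum]
    rw [Finset.sum_sum_comm_sum_sum]
    refine Finset.sum_congr rfl fun k _ => Finset.sum_congr rfl fun l _ =>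
      Finset.sum_congr rfl fun i _ => Finset.sum_congr rfl fun j _ => ?_
    simp only [Algebra.smul_def, map_mul]
    ring
  rw [h1]
  have h2 : ∑ i, ((ψ (b 0))⁻¹ * polar ψ (b i.succ) (b 0)) • x i =
      (ψ (b 0))⁻¹ • ∑ i, (B (b i.succ) (b 0) + B (b 0) (b i.succ)) • x i := by
    simp only [polar_eq_add_of_self hB, mul_smul, Finset.smul_sum]
  rw [h2]
  simp only [Fin.sum_univ_succ, Fin.cons_zero, Fin.cons_succ, hB, mul_smul, ← Finset.smul_sum,
    smul_add, Finset.sum_add_distrib, smul_mul_assoc, smul_inv_smul₀ h0, add_smul, add_mul,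
    Finset.sum_mul, mul_comm y]
  abel

end ChangeOfCoordinates

section QuadraticCover

variable {F : Type} [Field F] {m : ℕ}

theorem exists_eq_aeval_add_aeval_mul {S : Type} [CommRing S] [Algebra F S] {t : Fin m → S} {y : S}
    {l q : MvPolynomial (Fin m) F} (hy : y * y + aeval t l * y + aeval t q = 0) {s : S}
    (hs : s ∈ Algebra.adjoin F (insert y (Set.range t))) :
    ∃ p p' : MvPolynomial (Fin m) F, s = aeval t p + aeval t p' * y := by
  induction hs using Algebra.adjoin_induction with
  | mem s hs =>
    rcases hs with rfl | ⟨i, rfl⟩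
    · exact ⟨0, 1, by simp⟩
    · exact ⟨X i, 0, by simp⟩
  | algebraMap c => exact ⟨MvPolynomial.C c, 0, by simp⟩
  | add s s' _ _ h h' =>
    obtain ⟨p, p', rfl⟩ := h
    obtain ⟨r, r', rfl⟩ := h'
    exact ⟨p + r, p' + r', by simp only [map_add]; ring⟩
  | mul s s' _ _ h h' =>
    obtain ⟨p, p', rfl⟩ := h
    obtain ⟨r, r', rfl⟩ := h'
    refine ⟨p * r - p' * r' * q, p * r' + p' * r - p' * r' * l, ?_⟩
    simp only [map_add, map_sub, map_mul]
    linear_combination (aeval t p' * aeval t r') * hy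

variable {D R : Type} [DivisionRing D] [Algebra F D] [CommRing R] [Algebra F R]

/-- The map sending `∑ d_α t^α` to `∑ d_α ⊗ t^α s`. -/
noncomputable def monomialTmul (D : Type) [DivisionRing D] [Algebra F D] (t : Fin m → R) (s : R) :
    ((Fin m →₀ ℕ) →₀ D) →ₗ[F] D ⊗[F] R :=
  Finsupp.lsum F fun α => (TensorProduct.mk F D R).flip ((α.prod fun i k => t i ^ k) * s)

theorem monomialTmul_single (t : Fin m → R) (s : R) (α : Fin m →₀ ℕ) (d : D) :
    monomialTmul D t s (Finsupp.single α d) = d ⊗ₜ[F] ((α.prod fun i k => t i ^ k) * s) := by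
  simp [monomialTmul]

theorem tmul_aeval_mul_mem_range (t : Fin m → R) (s : R) (d : D) (p : MvPolynomial (Fin m) F) :
    d ⊗ₜ[F] (aeval t p * s) ∈ LinearMap.range (monomialTmul D t s) := by
  induction p using MvPolynomial.induction_on' with
  | monomial α a =>
    refine ⟨Finsupp.single α (a • d), ?_⟩
    rw [monomialTmul_single, aeval_monomial, TensorProduct.smul_tmul, Algebra.smul_def, mul_assoc]
  | add p p' h h' =>
    rw [map_add, add_mul, TensorProduct.tmul_add]
    exact add_mem h h'

theorem exists_eq_monomialTmul_add {t : Fin m → R} {y : R}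
    {l q : MvPolynomial (Fin m) F} (hy : y * y + aeval t l * y + aeval t q = 0)
    (hadj : Algebra.adjoin F (insert y (Set.range t)) = ⊤) (w : D ⊗[F] R) :
    ∃ c c', w = monomialTmul D t 1 c + monomialTmul D t y c' := by
  induction w with
  | zero => exact ⟨0, 0, by simp⟩
  | tmul d r =>
    obtain ⟨p, p', rfl⟩ := exists_eq_aeval_add_aeval_mul hy (hadj ▸ Algebra.mem_top : r ∈ _)
    obtain ⟨c, hc⟩ := tmul_aeval_mul_mem_range t 1 d p
    obtain ⟨c', hc'⟩ := tmul_aeval_mul_mem_range t y d p'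
    exact ⟨c, c', by rw [hc, hc', mul_one, TensorProduct.tmul_add]⟩
  | add w w' h h' =>
    obtain ⟨c, c', rfl⟩ := h
    obtain ⟨e, e', rfl⟩ := h'
    exact ⟨c + e, c' + e', by rw [map_add, map_add]; abel⟩

variable {K Z : Type} [DivisionRing K] [CommRing Z] [Algebra F K] [Algebra F Z] [Algebra Z K]
  [IsScalarTower F Z K]

/-- A double cover `y² + l y + q = 0` of affine space stays integral over `D` if the quadratic
equation has no root in some extension of `D` containing independent central indeterminates. -/
theorem eq_zero_or_eq_zero_of_quadratic_cover (j : D →ₐ[F] K) {x : Fin m → Z}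
    (hx : ∀ c : (Fin m →₀ ℕ) →₀ D,
      (c.sum fun α d => j d * algebraMap Z K (α.prod fun i k => x i ^ k)) = 0 → c = 0)
    {l q : MvPolynomial (Fin m) F}
    (hno : ∀ θ : K, θ * θ + algebraMap Z K (aeval x l) * θ + algebraMap Z K (aeval x q) ≠ 0)
    {t : Fin m → R} {y : R} (hy : y * y + aeval t l * y + aeval t q = 0)
    (hadj : Algebra.adjoin F (insert y (Set.range t)) = ⊤)
    (ρ : R →ₐ[F] QuadraticAlgebra Z (-aeval x q) (-aeval x l))
    (hρt : ∀ i, ρ (t i) = algebraMap Z _ (x i)) (hρy : ρ y = QuadraticAlgebra.omega)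
    (u v : D ⊗[F] R) (huv : u * v = 0) : u = 0 ∨ v = 0 := by
  let C := QuadraticAlgebra Z (-aeval x q) (-aeval x l)
  let f : D →ₐ[F] K ⊗[Z] C := (Algebra.TensorProduct.includeLeft : K →ₐ[F] K ⊗[Z] C).comp j
  let g : R →ₐ[F] K ⊗[Z] C :=
    ((Algebra.TensorProduct.includeRight : C →ₐ[Z] K ⊗[Z] C).restrictScalars F).comp ρ
  let Φ : D ⊗[F] R →ₐ[F] K ⊗[Z] C := Algebra.TensorProduct.lift f g fun d r => by
    simp [Commute, SemiconjBy, f, g]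
  have hΦ : ∀ d r, Φ (d ⊗ₜ r) = j d ⊗ₜ ρ r := fun d r => by
    refine (Algebra.TensorProduct.lift_tmul f g _ d r).trans ?_
    simp [f, g]
  have hmon : ∀ c s, Φ (monomialTmul D t s c) =
      (c.sum fun α d => j d * algebraMap Z K (α.prod fun i k => x i ^ k)) ⊗ₜ ρ s := by
    intro c s
    induction c using Finsupp.induction_linear with
    | zero => simp
    | add c c' h h' =>
      rw [map_add, map_add, h, h', ← TensorProduct.add_tmul, Finsupp.sum_add_index'] <;>
        simp [add_mul]
    | single α d =>
      rw [monomialTmul_single, hΦ, Finsupp.sum_single_index (by simp), map_mul, Finsupp.prod,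
        map_prod, ← Algebra.commutes, ← Algebra.smul_def, TensorProduct.smul_tmul,
        Algebra.smul_def, Finsupp.prod, map_prod]
      simp [hρt]
  have hinj : ∀ w, Φ w = 0 → w = 0 := by
    intro w hw
    obtain ⟨c, c', rfl⟩ := exists_eq_monomialTmul_add hy hadj w
    rw [map_add, hmon, hmon, map_one, hρy] at hw
    obtain ⟨h1, h2⟩ := QuadraticAlgebra.tmul_one_add_tmul_omega_eq_zero hw
    rw [hx c h1, hx c' h2, map_zero, map_zero, add_zero]
  exact (QuadraticAlgebra.eq_zero_or_eq_zero_of_mul_eq_zero hno (Φ u) (Φ v)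
    (by rw [← map_mul, huv, map_zero])).imp (hinj u) (hinj v)

end QuadraticCover

section Anisotropy

variable {F : Type} [Field F] {n m : ℕ}

theorem exists_funFieldRing_lift {S : Type} [CommRing S] [Algebra F S]
    (ψ : QuadraticForm F (Fin n → F)) {z : Fin n → S} (hz : aeval z (qfPoly F ψ) = 0) :
    ∃ ρ : FunFieldRing F ψ →ₐ[F] S, ∀ p, ρ (funFieldRingMk ψ p) = aeval z p := by
  refine ⟨Ideal.Quotient.liftₐ _ (aeval z) fun p hp => ?_, fun p => rfl⟩
  obtain ⟨r, rfl⟩ := Ideal.mem_span_singleton.1 hp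
  rw [map_mul, hz, zero_mul]

theorem sum_repr_smul_sum_smul {S : Type} [AddCommGroup S] [Module F S]
    (b : Module.Basis (Fin (m + 1)) F (Fin n → F)) (w : Fin (m + 1) → S) (i : Fin (m + 1)) :
    ∑ k, b.repr (Pi.single k 1) i • ∑ i, b i k • w i = w i := by
  have h : ∀ j, ∑ k, b.repr (Pi.single k 1) i * b j k = if j = i then 1 else 0 := fun j => by
    have h1 := DFunLike.congr_fun (congrArg b.repr ((Pi.basisFun F (Fin n)).sum_repr (b j))) i
    simpa [Finsupp.single_apply, mul_comm] using h1
  simp only [Finset.smul_sum, smul_smul]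
  rw [Finset.sum_comm]
  simp [← Finset.sum_smul, h]

theorem sum_smul_sum_repr_smul {S : Type} [AddCommGroup S] [Module F S]
    (b : Module.Basis (Fin (m + 1)) F (Fin n → F)) (z : Fin n → S) (k : Fin n) :
    ∑ i, b i k • ∑ l, b.repr (Pi.single l 1) i • z l = z k := by
  have h : ∀ l, ∑ i, b i k * b.repr (Pi.single l 1) i = if l = k then 1 else 0 := fun l => by
    have h1 := congrFun (b.sum_repr (Pi.single l 1)) k
    simpa [Pi.single_apply, mul_comm, eq_comm] using h1
  simp only [Finset.smul_sum, smul_smul]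
  rw [Finset.sum_comm]
  simp [← Finset.sum_smul, h]

/-- If, in some extension of `D` containing independent central indeterminates, the equation of
the quadric is not solvable for the first coordinate, then `D` remains a division algebra over the
function field of the quadric. -/
theorem isDivisionAlgebra_of_forall_ne_zero {D K Z : Type} [DivisionRing D] [Algebra F D]
    [FiniteDimensional F D] [DivisionRing K] [CommRing Z] [Algebra F K] [Algebra F Z] [Algebra Z K]
    [IsScalarTower F Z K] (ψ : QuadraticForm F (Fin n → F))
    (b : Module.Basis (Fin (m + 1)) F (Fin n → F)) {l q : MvPolynomial (Fin m) F} {a : F}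
    (ha : a ≠ 0)
    (haeval : ∀ {S : Type} [CommRing S] [Algebra F S] (y : S) (t : Fin m → S),
      aeval (fun k => ∑ i, b i k • Fin.cons (α := fun _ => S) y t i) (qfPoly F ψ) =
        a • (y * y + aeval t l * y + aeval t q))
    (j : D →ₐ[F] K) {x : Fin m → Z}
    (hx : ∀ c : (Fin m →₀ ℕ) →₀ D,
      (c.sum fun α d => j d * algebraMap Z K (α.prod fun i k => x i ^ k)) = 0 → c = 0)
    (hno : ∀ θ : K, θ * θ + algebraMap Z K (aeval x l) * θ + algebraMap Z K (aeval x q) ≠ 0) :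
    IsDivisionAlgebra (D ⊗[F] FunField F ψ) := by
  let S := QuadraticAlgebra Z (-aeval x q) (-aeval x l)
  let v : Fin (m + 1) → S :=
    Fin.cons (α := fun _ => S) QuadraticAlgebra.omega fun i => algebraMap Z S (x i)
  obtain ⟨ρ, hρ⟩ := exists_funFieldRing_lift ψ (z := fun k => ∑ i, b i k • v i) (by
    have h1 : ∀ p : MvPolynomial (Fin m) F, aeval (fun i => algebraMap Z S (x i)) p =
        algebraMap Z S (aeval x p) :=
      fun p => aeval_algebraMap_apply S x p
    rw [haeval, h1, h1, QuadraticAlgebra.omega_mul_omega_eq_add]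
    simp only [Algebra.algebraMap_eq_smul_one, neg_smul, smul_mul_assoc, one_mul]
    abel_nf
    simp)
  let w : Fin (m + 1) → FunFieldRing F ψ := fun i =>
    ∑ k, b.repr (Pi.single k 1) i • funFieldRingMk ψ (X k)
  have hw : ∀ k, ∑ i, b i k • w i = funFieldRingMk ψ (X k) :=
    sum_smul_sum_repr_smul b fun k => funFieldRingMk ψ (X k)
  have hρw : ∀ i, ρ (w i) = v i := fun i => by
    simp only [w, map_sum, map_smul, hρ, aeval_X]
    exact sum_repr_smul_sum_smul b _ i
  have hy : w 0 * w 0 + aeval (Fin.tail w) l * w 0 + aeval (Fin.tail w) q = 0 := by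
    have h1 := haeval (w 0) (Fin.tail w)
    rw [Fin.cons_self_tail] at h1
    simp only [hw] at h1
    have h2 : aeval (fun k => funFieldRingMk ψ (X k)) (qfPoly F ψ) = 0 :=
      (DFunLike.congr_fun (aeval_unique (funFieldRingMk ψ)) _).symm.trans
        ((funFieldRingMk_eq_zero_iff _ _).2 dvd_rfl)
    exact (smul_eq_zero_iff_right ha).1 (h1.symm.trans h2)
  have hadj : Algebra.adjoin F (insert (w 0) (Set.range (Fin.tail w))) = ⊤ := by
    rw [eq_top_iff]
    rintro r -
    obtain ⟨p, rfl⟩ := funFieldRingMk_surjective ψ r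
    induction p using MvPolynomial.induction_on with
    | C c => exact (AlgHom.commutes (funFieldRingMk ψ) c) ▸ Subalgebra.algebraMap_mem _ c
    | add p p' h h' =>
      rw [map_add]
      exact add_mem h h'
    | mul_X p k h =>
      rw [map_mul, ← hw]
      refine mul_mem h (sum_mem fun i _ => Subalgebra.smul_mem _ (Algebra.subset_adjoin ?_) _)
      refine Fin.cases (Set.mem_insert _ _) (fun i => ?_) i
      exact Set.mem_insert_of_mem _ ⟨i, rfl⟩
  have hdom := eq_zero_or_eq_zero_of_quadratic_cover j hx hno hy hadj ρ
    (fun i => hρw i.succ) (hρw 0)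
  have hinj : Function.Injective (Algebra.TensorProduct.includeRight :
      FunFieldRing F ψ →ₐ[F] D ⊗[F] FunFieldRing F ψ) :=
    Algebra.TensorProduct.includeRight_injective (algebraMap F D).injective
  have hdom' : ∀ r s : FunFieldRing F ψ, r * s = 0 → r = 0 ∨ s = 0 := fun r s h =>
    (hdom (1 ⊗ₜ r) (1 ⊗ₜ s) (by simp [h])).imp
      (fun h0 => hinj (h0.trans (map_zero _).symm)) (fun h0 => hinj (h0.trans (map_zero _).symm))
  have : NoZeroDivisors (FunFieldRing F ψ) := ⟨fun {r s} => hdom' r s⟩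
  have : Nontrivial (FunFieldRing F ψ) := by
    have : Nontrivial Z := (algebraMap Z K).domain_nontrivial
    exact (ρ : FunFieldRing F ψ →+* S).domain_nontrivial
  have : IsDomain (FunFieldRing F ψ) := NoZeroDivisors.to_isDomain _
  exact isDivisionAlgebra_tensorProduct_of_noZeroDivisors hdom

/-- If the even Clifford algebra of `ψ` does not map to `D`, then `D` remains a division algebra
over the function field of `ψ`. -/
theorem isDivisionAlgebra_of_isEmpty_even_algHom [CharP F 2] {D : Type} [DivisionRing D]
    [Algebra F D] [FiniteDimensional F D] (ψ : QuadraticForm F (Fin n → F))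
    (b : Module.Basis (Fin (m + 1)) F (Fin n → F)) (h0 : ψ (b 0) ≠ 0)
    (hφ : IsEmpty (CliffordAlgebra.even ψ →ₐ[F] D)) : IsDivisionAlgebra (D ⊗[F] FunField F ψ) := by
  obtain ⟨B, hB, hB'⟩ := exists_bilinForm_of_quadraticForm ψ
  obtain ⟨K, _, j, x, hj, hx, hroot⟩ := exists_generic_extension m D
  let : Algebra F K := (j.comp (algebraMap F D)).toAlgebra' fun c z =>
    hj _ (fun e => Algebra.commutes c e) z
  let : Algebra F (Subring.center K) := ((algebraMap F K).codRestrict (Subring.center K) fun c =>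
    Subring.mem_center_iff.2 fun z => (Algebra.commutes c z).symm).toAlgebra
  have : IsScalarTower F (Subring.center K) K := .of_algebraMap_eq fun _ => rfl
  have hjF : ∀ c, j (algebraMap F D c) = algebraMap F K c := fun _ => rfl
  refine isDivisionAlgebra_of_forall_ne_zero (Z := Subring.center K) ψ b (a := ψ (b 0))
    (l := ∑ i, ((ψ (b 0))⁻¹ * polar ψ (b i.succ) (b 0)) • X i)
    (q := ∑ i, ∑ k, ((ψ (b 0))⁻¹ * B (b i.succ) (b k.succ)) • (X i * X k)) h0 (fun y t => ?_)
    (AlgHom.mk j hjF) hx fun θ hθ => ?_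
  · rw [aeval_qfPoly_eq hB hB' b h0]
    simp
  · obtain ⟨a, ha⟩ := hroot
      (Fin.cons 0 fun i => algebraMap F D ((ψ (b 0))⁻¹ * polar ψ (b i.succ) (b 0)))
      (Fin.cons 0 fun i => Fin.cons 0 fun k =>
        algebraMap F D ((ψ (b 0))⁻¹ * B (b i.succ) (b k.succ)))
      (Fin.cases (fun e => Commute.zero_left e) fun i e => Algebra.commutes _ e)
      (Fin.cases (fun k e => Commute.zero_left e) fun i =>
        Fin.cases (fun e => Commute.zero_left e) fun k e => Algebra.commutes _ e) θ (by
      rw [← hθ]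
      simp only [Fin.sum_univ_succ, Fin.cons_zero, Fin.cons_succ, map_sum, map_mul, hjF,
        Pi.zero_apply, map_zero, zero_mul, zero_add, Finset.sum_const_zero, aeval_X,
        Algebra.smul_def, AlgHom.commutes, ← IsScalarTower.algebraMap_apply]
      rfl)
    refine (CliffordAlgebra.exists_even_algHom_of_rep ψ b B hB h0 (fun i => a i.succ)
      ⟨fun i => ?_, fun i k hik => ?_⟩).elim hφ.elim
    · exact ha.1 i.succ
    · exact ha.2 i.succ k.succ (Fin.succ_injective _ |>.ne hik)

end Anisotropy

theorem exists_basis_zero_eq {F : Type*} [Field F] {m : ℕ} {v : Fin (m + 1) → F} (hv : v ≠ 0) :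
    ∃ b : Module.Basis (Fin (m + 1)) F (Fin (m + 1) → F), b 0 = v := by
  have hli : LinearIndepOn F id {v} := by simpa using hv
  let c := Module.Basis.extend hli
  have hmem : v ∈ hli.extend (Set.subset_univ _) := hli.subset_extend _ rfl
  let e := c.indexEquiv (Pi.basisFun F (Fin (m + 1)))
  refine ⟨c.reindex (e.trans (Equiv.swap (e ⟨v, hmem⟩) 0)), ?_⟩
  simp [c]

theorem stmt15 (F : Type) [Field F] [CharP F 2]
    (D : Type) [DivisionRing D] [Algebra F D] [FiniteDimensional F D]
    (hcentral : Subalgebra.center F D = ⊥)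
    (n : ℕ) (hn : 2 ≤ n) (ψ : QuadraticForm F (Fin n → F))
    (hψns : ∃ (r : ℕ) (a b : Fin r → F), ψ.Equivalent (binsQF a b))
    (harf : ∀ (r : ℕ) (a b : Fin r → F), ψ.Equivalent (binsQF a b) →
      (∑ i, a i * b i) ∉ ArtinSchreier F) :
    (¬ IsDivisionAlgebra (D ⊗[F] FunField F ψ) ↔
      ∃ A : Subalgebra F D, Nonempty (↥A ≃ₐ[F] ↥(CliffordAlgebra.even ψ))) := by
  obtain ⟨r, a, b, h⟩ := hψns
  have hc := harf r a b h
  obtain ⟨v, hv⟩ := exists_anisotropic_of_equivalent h hc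
  constructor
  · intro hdiv
    obtain ⟨m, rfl⟩ : ∃ m, n = m + 1 := ⟨n - 1, by omega⟩
    have hv0 : v ≠ 0 := fun h0 => hv (by rw [h0, QuadraticMap.map_zero])
    obtain ⟨e, he⟩ := exists_basis_zero_eq hv0
    rcases isEmpty_or_nonempty (CliffordAlgebra.even ψ →ₐ[F] D) with hφ | ⟨⟨φ⟩⟩
    · exact absurd (isDivisionAlgebra_of_isEmpty_even_algHom ψ e (by rwa [he]) hφ) hdiv
    · exact ⟨φ.range, ⟨(AlgEquiv.ofInjective φ
        (CliffordAlgebra.even_algHom_injective_of_equivalent h hc φ)).symm⟩⟩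
  · rintro ⟨A, ⟨e⟩⟩
    exact not_isDivisionAlgebra_of_even_algHom ψ hv (A.val.comp e.symm.toAlgHom)
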